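/- arXiv:0801.3626 — 2 statements merged into one kernel-verified Lean document; each statement's English description precedes it below -/
import Mathlib

section
/- Let L be a finite simplicial complex on vertex set V, k a field, m : V → ℤ weights with gcd 1 determining χ: G_L ↠ ℤ, Λ = k[t, t^{−1}], γ_v = t^{m_v} − 1, and r ≥ 1 an integer. The following are equivalent: (1) dim_k H_i(C_•(T_L, Λ_γ)) < ∞ for all i ≤ r; (2) β_i(k⟨L⟩, V_0(χ)) = 0 for all 1 ≤ i ≤ r, where V_0(χ) = {v : m_v ≠ 0}; (3) H̃_i(lk_{L_{V_0(χ)}}(σ), k) = 0 for all simplices σ ∈ L_{V∖V_0(χ)} (including the empty simplex) and all −1 ≤ i ≤ r − 1 − |σ|. -/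
open Finset

variable {V : Type} [Fintype V] [LinearOrder V]

/-- The set of faces of cardinality `c` of a finite family of finsets `L`
(for a simplicial complex, these index the `(c-1)`-simplices, with the empty
simplex corresponding to `c = 0`). -/
abbrev Face (L : Finset (Finset V)) (c : ℕ) := {σ : Finset V // σ ∈ L ∧ σ.card = c}

/-- `L` is (the face set of) a finite abstract simplicial complex:  it contains the
empty face and is closed under passing to subsets. -/
def IsCx (L : Finset (Finset V)) : Prop :=
  ∅ ∈ L ∧ ∀ σ ∈ L, ∀ τ ⊆ σ, τ ∈ L

/-- Incidence coefficient between a face `τ` and a face `σ` (intended: `τ ⊆ σ` with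
`|σ| = |τ| + 1`), twisted by the weights `z`:  if `σ = τ ∪ {v}` this is
`(-1)^{#{w ∈ τ : w < v}} ⬝ z v`, and `0` if `τ ⊄ σ`. -/
def coeffD {R : Type} [CommRing R] (z : V → R) (τ σ : Finset V) : R :=
  if τ ⊆ σ then ∑ v ∈ σ \ τ, (-1 : R) ^ (τ.filter (fun w => w < v)).card * z v else 0

/-- The boundary map `∂^z : C_{c+1}(T_L, R_z) → C_c(T_L, R_z)` of the twisted cellular
chain complex of the toric complex `T_L`:  on a basis element `c_σ`,
`σ = {v_1 < ⋯ < v_{c+1}}`, it is `∂^z c_σ = ∑ (-1)^{r-1} z_{v_r} c_{σ ∖ {v_r}}`. -/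
noncomputable def tB (R : Type) [CommRing R] (L : Finset (Finset V)) (z : V → R) (c : ℕ) :
    (Face L (c+1) → R) →ₗ[R] (Face L c → R) :=
  Matrix.mulVecLin (fun (τ : Face L c) (σ : Face L (c+1)) => coeffD z τ.1 σ.1)

/-- The Aomoto differential on the exterior Stanley--Reisner ring `k⟨L⟩`:  the degree-`c`
piece of `k⟨L⟩` has basis the faces of cardinality `c`, and right multiplication by
`z = ∑ z_v v*` sends the monomial `e_τ` to `∑_{v : τ ∪ {v} ∈ L} ± z_v e_{τ ∪ {v}}`. -/
noncomputable def aD (k : Type) [Field k] (L : Finset (Finset V)) (z : V → k) (c : ℕ) :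
    (Face L c → k) →ₗ[k] (Face L (c+1) → k) :=
  Matrix.mulVecLin (fun (σ : Face L (c+1)) (τ : Face L c) => coeffD z τ.1 σ.1)

/-- The Aomoto--Betti number `β_i(k⟨L⟩, z)`, the dimension of the `i`-th cohomology
of the Aomoto complex `(k⟨L⟩, ·z)`. -/
noncomputable def aomotoBetti (k : Type) [Field k] (L : Finset (Finset V)) (z : V → k)
    (i : ℕ) : ℕ :=
  Module.finrank k (LinearMap.ker (aD k L z i)) -
    (match i with
     | 0 => 0
     | j+1 => Module.finrank k (LinearMap.range (aD k L z j)))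

/-- The canonical degree-one element `z_W = ∑_{v ∈ W} v*` of `k⟨L⟩`, as a weight vector. -/
def zW (k : Type) [Field k] (W : Finset V) : V → k := fun v => if v ∈ W then 1 else 0

/-- The Aomoto--Betti number `β_i(k⟨L⟩, W) = β_i(k⟨L⟩, z_W)`. -/
noncomputable def aomotoBettiW (k : Type) [Field k] (L : Finset (Finset V)) (W : Finset V)
    (i : ℕ) : ℕ :=
  aomotoBetti k L (zW k W) i

/-- The cycles in cardinality-degree `n` of the twisted chain complex `C_•(T_L, R_z)`
(in degree `0` every chain is a cycle). -/
noncomputable def cyc (R : Type) [CommRing R] (L : Finset (Finset V)) (z : V → R) :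
    (n : ℕ) → Submodule R (Face L n → R)
  | 0 => ⊤
  | (m+1) => LinearMap.ker (tB R L z m)

/-- `dim_k H_n(C_•(T_L, k_z))`, the dimension of the `n`-th twisted homology of the
toric complex `T_L` with coefficients in the rank-one system determined by `z`. -/
noncomputable def twHomDim (k : Type) [Field k] (L : Finset (Finset V)) (z : V → k)
    (n : ℕ) : ℕ :=
  Module.finrank k ↥(cyc k L z n) - Module.finrank k ↥(LinearMap.range (tB k L z n))

/-- `dim_k H̃_j(K; k)`, the `j`-th reduced simplicial homology of the complex `K`
(the chain complex of `K` including the empty face is exactly the twisted complex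
with all weights equal to `1`; the degree-`j` reduced homology sits in
cardinality-degree `j+1`). -/
noncomputable def reducedBetti (k : Type) [Field k] (K : Finset (Finset V)) (j : ℤ) : ℕ :=
  if j < -1 then 0 else twHomDim k K (fun _ => (1 : k)) (j+1).toNat

/-- The link `lk_{L_W}(σ) = {τ ∈ L_W ∣ τ ∪ σ ∈ L}` of a face `σ` in the induced
subcomplex `L_W`. -/
def linkIn (L : Finset (Finset V)) (W σ : Finset V) : Finset (Finset V) :=
  L.filter (fun τ => τ ⊆ W ∧ τ ∪ σ ∈ L)

/-- The `n`-th homology of the twisted chain complex `C_•(T_L, R_z)`, as an `R`-module. -/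
noncomputable abbrev twHomology (R : Type) [CommRing R] (L : Finset (Finset V)) (z : V → R)
    (n : ℕ) :=
  ↥(cyc R L z n) ⧸ (LinearMap.range (tB R L z n)).comap (cyc R L z n).subtype

section Boundary

variable {R : Type} [CommRing R] {M N : Type} [AddCommGroup M] [Module R M]
  [AddCommGroup N] [Module R N]

/-- The twisted boundary operator on all functions `Finset V → M`, without reference to a
complex: `(∂f)(τ) = ∑_{v ∉ τ} ± z_v f(τ ∪ {v})`. -/
noncomputable def bd (z : V → R) : (Finset V → M) →ₗ[R] (Finset V → M) :=
  LinearMap.pi fun τ => ∑ v ∈ τᶜ,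
    ((-1 : R) ^ (τ.filter (fun w => w < v)).card * z v) • LinearMap.proj (insert v τ)

theorem bd_apply (z : V → R) (f : Finset V → M) (τ : Finset V) :
    bd z f τ = ∑ v ∈ τᶜ,
      ((-1 : R) ^ (τ.filter (fun w => w < v)).card * z v) • f (insert v τ) := by
  simp [bd]

/-- `f` is supported on the faces of `L` of cardinality `n`. -/
def SupportedOn (L : Finset (Finset V)) (n : ℕ) (f : Finset V → M) : Prop :=
  ∀ σ, ¬(σ ∈ L ∧ σ.card = n) → f σ = 0

/-- Exactness in cardinality-degree `n` of the twisted complex of `L` with coefficients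
in the module `M`. -/
def ExactAt (M : Type) [AddCommGroup M] [Module R M] (L : Finset (Finset V)) (z : V → R)
    (n : ℕ) : Prop :=
  ∀ f : Finset V → M, SupportedOn L n f → bd z f = 0 →
    ∃ g : Finset V → M, SupportedOn L (n + 1) g ∧ bd z g = f

theorem bd_map (z : V → R) (φ : M →ₗ[R] N) (f : Finset V → M) :
    bd z (fun σ => φ (f σ)) = fun σ => φ (bd z f σ) := by
  funext τ
  simp [bd_apply]

theorem bd_algebraMap {A : Type} [CommRing A] [Algebra R A] [Module A M] [IsScalarTower R A M]
    (z : V → R) (f : Finset V → M) :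
    bd (fun v => algebraMap R A (z v)) f = bd z f := by
  funext τ
  simp only [bd_apply]
  refine Finset.sum_congr rfl fun v _ => ?_
  rw [← algebraMap_smul A ((-1 : R) ^ _ * z v)]
  simp

theorem SupportedOn.bd {L : Finset (Finset V)} (hL : IsCx L) {z : V → R} {n : ℕ}
    {f : Finset V → M} (hf : SupportedOn L (n + 1) f) : SupportedOn L n (bd z f) := by
  intro τ hτ
  rw [bd_apply]
  refine Finset.sum_eq_zero fun v hv => ?_
  rw [hf, smul_zero]
  rintro ⟨h1, h2⟩
  rw [Finset.card_insert_of_notMem (by simpa using hv)] at h2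
  exact hτ ⟨hL.2 _ h1 _ (Finset.subset_insert _ _), by omega⟩

theorem card_filter_lt_insert {τ : Finset V} {v w : V} (hv : v ∉ τ) :
    ((insert v τ).filter (fun u => u < w)).card =
      (τ.filter (fun u => u < w)).card + if v < w then 1 else 0 := by
  rw [Finset.filter_insert]
  split_ifs with h
  · rw [Finset.card_insert_of_notMem (by simp [hv])]
  · simp

theorem bd_bd (z : V → R) (f : Finset V → M) : bd z (bd z f) = 0 := by
  funext τ
  simp only [bd_apply, Finset.smul_sum, Pi.zero_apply]
  rw [Finset.sum_sigma']
  have key : ∀ v w : V, v ∉ τ → w ∉ τ → v < w →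
      ((-1 : R) ^ (τ.filter (fun u => u < v)).card * z v) •
        ((-1 : R) ^ ((insert v τ).filter (fun u => u < w)).card * z w) •
          f (insert w (insert v τ)) +
      ((-1 : R) ^ (τ.filter (fun u => u < w)).card * z w) •
        ((-1 : R) ^ ((insert w τ).filter (fun u => u < v)).card * z v) •
          f (insert v (insert w τ)) = 0 := by
    intro v w hv hw hvw
    rw [card_filter_lt_insert hv, card_filter_lt_insert hw, if_pos hvw,
      if_neg (not_lt.mpr hvw.le), Finset.insert_comm w v, smul_smul, smul_smul, ← add_smul]
    convert zero_smul R (f (insert v (insert w τ))) using 2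
    ring
  refine Finset.sum_involution (fun a _ => ⟨a.2, a.1⟩) ?_ ?_ ?_ ?_
  · rintro ⟨v, w⟩ h
    simp only [Finset.mem_sigma, Finset.mem_compl, Finset.mem_insert, not_or] at h
    rcases lt_trichotomy v w with hvw | hvw | hvw
    · exact key v w h.1 h.2.2 hvw
    · exact absurd hvw.symm h.2.1
    · rw [add_comm]
      exact key w v h.2.2 h.1 hvw
  · rintro ⟨v, w⟩ h _ heq
    simp only [Finset.mem_sigma, Finset.mem_compl, Finset.mem_insert, not_or] at h
    simp only [Sigma.mk.injEq, heq_eq_eq] at heq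
    exact h.2.1 heq.1
  · rintro ⟨v, w⟩ h
    simp only [Finset.mem_sigma, Finset.mem_compl, Finset.mem_insert, not_or] at h ⊢
    exact ⟨h.2.2, fun h' => h.2.1 h'.symm, h.1⟩
  · rintro ⟨v, w⟩ _
    rfl

end Boundary

section FaceFunctions

variable {R : Type} [CommRing R] {L : Finset (Finset V)}

/-- Extension by zero of a function on the faces of cardinality `n`. -/
def extendFace {n : ℕ} (F : Face L n → R) (σ : Finset V) : R :=
  if h : σ ∈ L ∧ σ.card = n then F ⟨σ, h⟩ else 0

/-- Restriction to the faces of cardinality `n`. -/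
def restrictFace (L : Finset (Finset V)) (n : ℕ) (f : Finset V → R) (σ : Face L n) : R := f σ.1

theorem supportedOn_extendFace {n : ℕ} (F : Face L n → R) : SupportedOn L n (extendFace F) :=
  fun _ h => dif_neg h

theorem extendFace_val {n : ℕ} (F : Face L n → R) (σ : Face L n) : extendFace F σ.1 = F σ :=
  dif_pos σ.2

theorem extendFace_restrictFace {n : ℕ} {f : Finset V → R} (hf : SupportedOn L n f) :
    extendFace (restrictFace L n f) = f := by
  funext σ
  by_cases h : σ ∈ L ∧ σ.card = n
  · simp [extendFace, h, restrictFace]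
  · rw [hf σ h, supportedOn_extendFace _ σ h]

theorem extendFace_injective {n : ℕ} :
    Function.Injective (extendFace : (Face L n → R) → Finset V → R) := by
  intro F G h
  funext σ
  rw [← extendFace_val F, h, extendFace_val]

theorem coeffD_eq_sum (z : V → R) {τ σ : Finset V} (h : σ.card = τ.card + 1) :
    coeffD z τ σ = ∑ v ∈ τᶜ,
      if insert v τ = σ then (-1 : R) ^ (τ.filter (fun w => w < v)).card * z v else 0 := by
  unfold coeffD
  split_ifs with hs
  · rw [← Finset.sum_filter]
    refine Finset.sum_congr ?_ fun _ _ => rfl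
    ext v
    simp only [Finset.mem_sdiff, Finset.mem_filter, Finset.mem_compl]
    constructor
    · rintro ⟨h1, h2⟩
      refine ⟨h2, Finset.eq_of_subset_of_card_le (Finset.insert_subset h1 hs) ?_⟩
      rw [Finset.card_insert_of_notMem h2, h]
    · rintro ⟨h1, rfl⟩
      exact ⟨Finset.mem_insert_self _ _, h1⟩
  · symm
    refine Finset.sum_eq_zero fun v _ => if_neg ?_
    rintro rfl
    exact hs (Finset.subset_insert _ _)

theorem extendFace_tB (hL : IsCx L) (z : V → R) {n : ℕ} (F : Face L (n + 1) → R) :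
    extendFace (tB R L z n F) = bd z (extendFace F) := by
  funext τ
  by_cases h : τ ∈ L ∧ τ.card = n
  · rw [extendFace, dif_pos h, bd_apply]
    change ∑ σ : Face L (n + 1), coeffD z τ σ.1 * F σ = _
    have h1 : ∀ σ : Face L (n + 1), coeffD z τ σ.1 * F σ = ∑ v ∈ τᶜ,
        if insert v τ = σ.1 then
          ((-1 : R) ^ (τ.filter (fun w => w < v)).card * z v) * F σ else 0 := by
      intro σ
      rw [coeffD_eq_sum z (by rw [σ.2.2, h.2]), Finset.sum_mul]
      exact Finset.sum_congr rfl fun v _ => by split_ifs <;> simp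
    rw [Finset.sum_congr rfl fun σ _ => h1 σ, Finset.sum_comm]
    refine Finset.sum_congr rfl fun v _ => ?_
    by_cases hv : insert v τ ∈ L ∧ (insert v τ).card = n + 1
    · rw [Finset.sum_eq_single (⟨insert v τ, hv⟩ : Face L (n + 1))]
      · simp [extendFace, hv]
      · intro σ _ hσ
        exact if_neg fun h' => hσ (Subtype.ext h'.symm)
      · simp
    · rw [supportedOn_extendFace F _ hv, smul_zero]
      refine Finset.sum_eq_zero fun σ _ => if_neg ?_
      intro h'
      exact hv (h' ▸ σ.2)
  · rw [supportedOn_extendFace _ _ h, (supportedOn_extendFace F).bd hL _ h]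

theorem mem_cyc_iff (hL : IsCx L) (z : V → R) {n : ℕ} (F : Face L n → R) :
    F ∈ cyc R L z n ↔ bd z (extendFace F) = 0 := by
  cases n with
  | zero =>
    refine ⟨fun _ => ?_, fun _ => Submodule.mem_top⟩
    funext τ
    rw [bd_apply]
    refine Finset.sum_eq_zero fun v _ => ?_
    rw [supportedOn_extendFace F, smul_zero]
    simp
  | succ n =>
    change F ∈ LinearMap.ker _ ↔ _
    rw [LinearMap.mem_ker, ← extendFace_tB hL, ← (extendFace_injective (L := L)).eq_iff]
    have : extendFace (0 : Face L n → R) = 0 := by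
      funext σ
      simp [extendFace]
    rw [this]

theorem range_tB_le_cyc (hL : IsCx L) (z : V → R) (n : ℕ) :
    LinearMap.range (tB R L z n) ≤ cyc R L z n := by
  rintro _ ⟨F, rfl⟩
  rw [mem_cyc_iff hL, extendFace_tB hL, bd_bd]

theorem mem_range_tB_iff (hL : IsCx L) (z : V → R) {n : ℕ} (F : Face L n → R) :
    F ∈ LinearMap.range (tB R L z n) ↔
      ∃ g : Finset V → R, SupportedOn L (n + 1) g ∧ bd z g = extendFace F := by
  constructor
  · rintro ⟨G, rfl⟩
    exact ⟨extendFace G, supportedOn_extendFace G, (extendFace_tB hL z G).symm⟩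
  · rintro ⟨g, hg, h⟩
    refine ⟨restrictFace L (n + 1) g, extendFace_injective ?_⟩
    rw [extendFace_tB hL, extendFace_restrictFace hg, h]

theorem exactAt_iff_cyc_le_range (hL : IsCx L) (z : V → R) (n : ℕ) :
    ExactAt R L z n ↔ cyc R L z n ≤ LinearMap.range (tB R L z n) := by
  constructor
  · intro h F hF
    exact (mem_range_tB_iff hL z F).2
      (h _ (supportedOn_extendFace F) ((mem_cyc_iff hL z F).1 hF))
  · intro h f hf hz
    have := (mem_range_tB_iff hL z _).1 (h (x := restrictFace L n f)
      ((mem_cyc_iff hL z _).2 (by rwa [extendFace_restrictFace hf])))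
    rwa [extendFace_restrictFace hf] at this

end FaceFunctions

section OverField

variable {k : Type} [Field k] {L : Finset (Finset V)}

theorem twHomDim_eq_zero_iff (hL : IsCx L) (z : V → k) (n : ℕ) :
    twHomDim k L z n = 0 ↔ ExactAt k L z n := by
  rw [exactAt_iff_cyc_le_range hL, twHomDim, Nat.sub_eq_zero_iff_le]
  constructor
  · intro h
    exact (Submodule.eq_of_le_of_finrank_le (range_tB_le_cyc hL z n) h).ge
  · exact fun h => Submodule.finrank_mono h

theorem finrank_range_aD (L : Finset (Finset V)) (z : V → k) (n : ℕ) :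
    Module.finrank k (LinearMap.range (aD k L z n)) =
      Module.finrank k (LinearMap.range (tB k L z n)) :=
  Matrix.rank_transpose (fun (τ : Face L n) (σ : Face L (n + 1)) => coeffD z τ.1 σ.1)

theorem aomotoBetti_eq_twHomDim (L : Finset (Finset V)) (z : V → k) (n : ℕ) :
    aomotoBetti k L z n = twHomDim k L z n := by
  have h := LinearMap.finrank_range_add_finrank_ker (aD k L z n)
  rw [finrank_range_aD] at h
  cases n with
  | zero =>
    have h' : Module.finrank k (cyc k L z 0) = Module.finrank k (Face L 0 → k) := finrank_top _ _
    simp only [aomotoBetti, twHomDim]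
    omega
  | succ n =>
    have h' := LinearMap.finrank_range_add_finrank_ker (tB k L z n)
    have h'' := finrank_range_aD L z n
    change Module.finrank k (LinearMap.ker (aD k L z (n + 1))) -
        Module.finrank k (LinearMap.range (aD k L z n)) =
      Module.finrank k (LinearMap.ker (tB k L z n)) -
        Module.finrank k (LinearMap.range (tB k L z (n + 1)))
    rw [h'']
    omega

theorem ExactAt.of_smul_weights {z z' : V → k} (u : V → k) (hu : ∀ v, u v ≠ 0)
    (hz : ∀ v, z' v = z v * u v) {n : ℕ} (h : ExactAt k L z n) : ExactAt k L z' n := by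
  have hP : ∀ σ : Finset V, ∏ v ∈ σ, u v ≠ 0 := fun σ => Finset.prod_ne_zero_iff.2 fun v _ => hu v
  have key : ∀ (f : Finset V → k) (τ : Finset V),
      bd z (fun σ => (∏ v ∈ σ, u v) * f σ) τ = (∏ v ∈ τ, u v) * bd z' f τ := by
    intro f τ
    rw [bd_apply, bd_apply, Finset.mul_sum]
    refine Finset.sum_congr rfl fun v hv => ?_
    rw [Finset.prod_insert (by simpa using hv), hz]
    simp only [smul_eq_mul]
    ring
  intro f hf hf0
  obtain ⟨g, hg, hgf⟩ := h (fun σ => (∏ v ∈ σ, u v) * f σ)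
    (fun σ hσ => by simp [hf σ hσ]) (by funext τ; rw [key, hf0]; simp)
  have hg' : (fun σ => (∏ v ∈ σ, u v) * ((∏ v ∈ σ, u v)⁻¹ * g σ)) = g := by
    funext σ
    rw [mul_inv_cancel_left₀ (hP σ)]
  refine ⟨fun σ => (∏ v ∈ σ, u v)⁻¹ * g σ, fun σ hσ => by simp [hg σ hσ], ?_⟩
  funext τ
  refine mul_left_cancel₀ (hP τ) ?_
  rw [← key, hg', hgf]

theorem exactAt_congr_weights {z z' : V → k} (h : ∀ v, z v = 0 ↔ z' v = 0) (n : ℕ) :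
    ExactAt k L z n ↔ ExactAt k L z' n := by
  classical
  have key : ∀ {z z' : V → k}, (∀ v, z v = 0 ↔ z' v = 0) → ExactAt k L z n →
      ExactAt k L z' n := by
    intro z z' h
    refine ExactAt.of_smul_weights (fun v => if z v = 0 then 1 else z' v / z v) ?_ ?_
    · intro v
      split_ifs with hv
      · exact one_ne_zero
      · exact div_ne_zero (fun h' => hv ((h v).2 h')) hv
    · intro v
      split_ifs with hv
      · rw [hv, zero_mul, (h v).1 hv]
      · field_simp
  exact ⟨key h, key fun v => (h v).symm⟩

theorem exactAt_zero_of_vertex {z : V → k} {v : V} (hv : {v} ∈ L) (hz : z v ≠ 0) :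
    ExactAt k L z 0 := by
  intro f hf _
  refine ⟨fun σ => if σ = {v} then f ∅ / z v else 0, fun σ hσ => if_neg ?_, ?_⟩
  · rintro rfl
    exact hσ ⟨hv, by simp⟩
  · funext τ
    rw [bd_apply]
    by_cases hτ : τ = ∅
    · subst hτ
      rw [Finset.sum_eq_single v]
      · simp only [Finset.filter_empty, Finset.card_empty, pow_zero, one_mul, smul_eq_mul,
          insert_empty_eq, if_true]
        field_simp
      · intro w _ hw
        simp [hw]
      · simp
    · rw [hf τ (by simp [hτ])]
      refine Finset.sum_eq_zero fun w hw => ?_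
      rw [if_neg, smul_zero]
      intro h'
      have h1 := congrArg Finset.card h'
      rw [Finset.card_insert_of_notMem (by simpa using hw)] at h1
      simp [hτ] at h1

end OverField

section Slices

variable {k : Type} [Field k] {L : Finset (Finset V)} {W : Finset V}

/-- The sign of the shuffle moving `τ` past `σ`. -/
def shuffleSign (k : Type) [Field k] (σ τ : Finset V) : k :=
  ∏ v ∈ τ, (-1 : k) ^ (σ.filter (fun w => w < v)).card

/-- The part of a chain `f` supported on the faces `ρ` with `ρ ∖ W = σ`, regarded as a chain
on the subsets of `W`. -/
def linkSlice (W : Finset V) (f : Finset V → k) (σ τ : Finset V) : k :=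
  if τ ⊆ W then shuffleSign k σ τ * f (σ ∪ τ) else 0

/-- The chain with prescribed slices. -/
def assemble (W : Finset V) (F : Finset V → Finset V → k) (ρ : Finset V) : k :=
  shuffleSign k (ρ \ W) (ρ ∩ W) * F (ρ \ W) (ρ ∩ W)

theorem shuffleSign_mul_self (σ τ : Finset V) : shuffleSign k σ τ * shuffleSign k σ τ = 1 := by
  rw [shuffleSign, ← Finset.prod_mul_distrib]
  refine Finset.prod_eq_one fun v _ => ?_
  rw [← mul_pow]
  simp

theorem shuffleSign_ne_zero (σ τ : Finset V) : shuffleSign k σ τ ≠ 0 :=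
  left_ne_zero_of_mul_eq_one (shuffleSign_mul_self σ τ)

theorem linkSlice_eq_zero_of_not_subset (f : Finset V → k) (σ : Finset V) {τ : Finset V}
    (h : ¬τ ⊆ W) : linkSlice W f σ τ = 0 := if_neg h

theorem bd_linkSlice (f : Finset V → k) {σ : Finset V} (hσ : Disjoint σ W) :
    bd (fun _ => (1 : k)) (linkSlice W f σ) = linkSlice W (bd (zW k W) f) σ := by
  funext τ
  rw [bd_apply]
  by_cases hτ : τ ⊆ W
  · have hsub : (σ ∪ τ)ᶜ ⊆ τᶜ := Finset.compl_subset_compl.2 Finset.subset_union_right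
    rw [linkSlice, if_pos hτ, bd_apply, Finset.sum_subset hsub, Finset.mul_sum]
    · refine Finset.sum_congr rfl fun v hv => ?_
      by_cases hvW : v ∈ W
      · have hdisj : Disjoint (σ.filter (fun w => w < v)) (τ.filter (fun w => w < v)) :=
          Finset.disjoint_filter_filter (hσ.mono_right hτ)
        rw [linkSlice, if_pos (Finset.insert_subset hvW hτ), zW, if_pos hvW, Finset.filter_union,
          Finset.card_union_of_disjoint hdisj, pow_add, shuffleSign,
          Finset.prod_insert (by simpa using hv), ← shuffleSign, Finset.union_insert]
        simp only [smul_eq_mul]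
        ring
      · rw [linkSlice_eq_zero_of_not_subset _ _ fun h => hvW (h (Finset.mem_insert_self _ _))]
        simp [zW, hvW]
    · intro v hv hv'
      have : v ∈ σ := by
        simp only [Finset.mem_compl, Finset.mem_union, not_not] at hv hv'
        tauto
      simp [zW, Finset.disjoint_left.1 hσ this]
  · rw [linkSlice_eq_zero_of_not_subset _ _ hτ]
    refine Finset.sum_eq_zero fun v _ => ?_
    rw [linkSlice_eq_zero_of_not_subset _ _ fun h => hτ ((Finset.subset_insert _ _).trans h),
      smul_zero]

theorem linkSlice_assemble (F : Finset V → Finset V → k) {σ : Finset V} (hσ : Disjoint σ W)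
    (hF : ∀ τ, ¬τ ⊆ W → F σ τ = 0) : linkSlice W (assemble W F) σ = F σ := by
  funext τ
  by_cases hτ : τ ⊆ W
  · have h1 : (σ ∪ τ) \ W = σ := by
      rw [Finset.union_sdiff_distrib, Finset.sdiff_eq_empty_iff_subset.2 hτ, Finset.union_empty,
        Finset.sdiff_eq_self_of_disjoint hσ]
    have h2 : (σ ∪ τ) ∩ W = τ := by
      rw [Finset.union_inter_distrib_right, Finset.disjoint_iff_inter_eq_empty.1 hσ,
        Finset.empty_union, Finset.inter_eq_left.2 hτ]
    rw [linkSlice, if_pos hτ, assemble, h1, h2, ← mul_assoc, shuffleSign_mul_self, one_mul]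
  · rw [linkSlice_eq_zero_of_not_subset _ _ hτ, hF τ hτ]

theorem eq_of_linkSlice_eq {f g : Finset V → k}
    (h : ∀ σ, Disjoint σ W → linkSlice W f σ = linkSlice W g σ) : f = g := by
  funext ρ
  have h1 := congrFun (h (ρ \ W) Finset.sdiff_disjoint) (ρ ∩ W)
  rw [linkSlice, linkSlice, if_pos Finset.inter_subset_right, if_pos Finset.inter_subset_right,
    Finset.sdiff_union_inter] at h1
  exact mul_left_cancel₀ (shuffleSign_ne_zero _ _) h1

theorem linkSlice_zero (σ : Finset V) : linkSlice W (0 : Finset V → k) σ = 0 := by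
  funext τ
  simp [linkSlice]

theorem mem_linkIn {σ τ : Finset V} :
    τ ∈ linkIn L W σ ↔ τ ∈ L ∧ τ ⊆ W ∧ τ ∪ σ ∈ L := Finset.mem_filter

theorem isCx_linkIn (hL : IsCx L) {σ : Finset V} (hσ : σ ∈ L) : IsCx (linkIn L W σ) := by
  refine ⟨mem_linkIn.2 ⟨hL.1, Finset.empty_subset _, by simpa using hσ⟩, fun τ hτ ρ hρ => ?_⟩
  obtain ⟨h1, h2, h3⟩ := mem_linkIn.1 hτ
  exact mem_linkIn.2 ⟨hL.2 _ h1 _ hρ, hρ.trans h2,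
    hL.2 _ h3 _ (Finset.union_subset_union_left hρ)⟩

theorem supportedOn_linkSlice (hL : IsCx L) {n : ℕ} {f : Finset V → k} (hf : SupportedOn L n f)
    {σ : Finset V} (hσ : Disjoint σ W) :
    SupportedOn (linkIn L W σ) (n - σ.card) (linkSlice W f σ) := by
  intro τ hτ
  by_cases hτW : τ ⊆ W
  · rw [linkSlice, if_pos hτW, hf, mul_zero]
    rintro ⟨h1, h2⟩
    rw [Finset.card_union_of_disjoint (hσ.mono_right hτW)] at h2
    exact hτ ⟨mem_linkIn.2 ⟨hL.2 _ h1 _ Finset.subset_union_right, hτW,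
      by rwa [Finset.union_comm]⟩, by omega⟩
  · exact linkSlice_eq_zero_of_not_subset _ _ hτW

theorem supportedOn_assemble {n : ℕ} {F : Finset V → Finset V → k}
    (hF : ∀ σ τ, F σ τ ≠ 0 → σ ∪ τ ∈ L ∧ σ.card + τ.card = n) :
    SupportedOn L n (assemble W F) := by
  intro ρ hρ
  by_contra h
  obtain ⟨h1, h2⟩ := hF _ _ (right_ne_zero_of_mul h)
  rw [Finset.sdiff_union_inter] at h1
  rw [Finset.card_sdiff_add_card_inter] at h2
  exact hρ ⟨h1, h2⟩

theorem exactAt_zW_of_exactAt_linkIn (hL : IsCx L) {n : ℕ}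
    (h : ∀ σ ∈ L, Disjoint σ W → σ.card ≤ n →
      ExactAt k (linkIn L W σ) (fun _ => (1 : k)) (n - σ.card)) :
    ExactAt k L (zW k W) n := by
  intro f hf hf0
  have hex : ∀ σ : Finset V, ∃ g : Finset V → k,
      (Disjoint σ W → bd (fun _ => (1 : k)) g = linkSlice W f σ) ∧
      ∀ τ, g τ ≠ 0 → τ ⊆ W ∧ σ ∪ τ ∈ L ∧ σ.card + τ.card = n + 1 := by
    intro σ
    by_cases hσ : Disjoint σ W ∧ σ ∈ L ∧ σ.card ≤ n
    · obtain ⟨hd, hσL, hc⟩ := hσ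
      obtain ⟨g, hg, hgf⟩ := h σ hσL hd hc (linkSlice W f σ) (supportedOn_linkSlice hL hf hd)
        (by rw [bd_linkSlice f hd, hf0, linkSlice_zero])
      refine ⟨g, fun _ => hgf, fun τ hτ => ?_⟩
      obtain ⟨h1, h2⟩ := not_not.1 (mt (hg τ) hτ)
      obtain ⟨-, h3, h4⟩ := mem_linkIn.1 h1
      exact ⟨h3, by rwa [Finset.union_comm], by omega⟩
    · refine ⟨0, fun hd => ?_, fun τ hτ => absurd rfl hτ⟩
      rw [map_zero]
      symm
      funext τ
      by_cases hτ : τ ⊆ W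
      · rw [linkSlice, if_pos hτ, hf, mul_zero, Pi.zero_apply]
        rintro ⟨h1, h2⟩
        exact hσ ⟨hd, hL.2 _ h1 _ Finset.subset_union_left,
          h2 ▸ Finset.card_le_card Finset.subset_union_left⟩
      · exact linkSlice_eq_zero_of_not_subset _ _ hτ
  choose F hF hFs using hex
  refine ⟨assemble W F, supportedOn_assemble fun σ τ hστ => (hFs σ τ hστ).2, ?_⟩
  refine eq_of_linkSlice_eq (W := W) fun σ hσ => ?_
  rw [← bd_linkSlice _ hσ, linkSlice_assemble F hσ, hF σ hσ]
  exact fun τ hτ => not_not.1 fun h0 => hτ (hFs σ τ h0).1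

theorem ExactAt.linkIn (hL : IsCx L) {n : ℕ} (h : ExactAt k L (zW k W) n) {σ : Finset V}
    (hσ : Disjoint σ W) (hc : σ.card ≤ n) :
    ExactAt k (linkIn L W σ) (fun _ => (1 : k)) (n - σ.card) := by
  intro f hf hf0
  set F : Finset V → Finset V → k := fun σ' => if σ' = σ then f else 0 with hFdef
  have hFσ : F σ = f := if_pos rfl
  have hfW : ∀ τ, f τ ≠ 0 → τ ⊆ W ∧ σ ∪ τ ∈ L ∧ σ.card + τ.card = n := by
    intro τ hτ
    obtain ⟨h1, h2⟩ := not_not.1 (mt (hf τ) hτ)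
    obtain ⟨-, h3, h4⟩ := mem_linkIn.1 h1
    exact ⟨h3, by rwa [Finset.union_comm], by omega⟩
  have hF : ∀ σ' τ, F σ' τ ≠ 0 → τ ⊆ W ∧ σ' ∪ τ ∈ L ∧ σ'.card + τ.card = n := by
    intro σ' τ h0
    by_cases hσ' : σ' = σ
    · subst hσ'
      exact hfW τ (by rwa [hFσ] at h0)
    · exact absurd (by simp [hFdef, hσ']) h0
  have hFW : ∀ σ' τ, ¬τ ⊆ W → F σ' τ = 0 :=
    fun σ' τ hτ => not_not.1 fun h0 => hτ (hF σ' τ h0).1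
  obtain ⟨g, hg, hgf⟩ := h (assemble W F) (supportedOn_assemble fun σ' τ h0 => (hF σ' τ h0).2) (by
    refine eq_of_linkSlice_eq (W := W) fun σ' hσ' => ?_
    rw [← bd_linkSlice _ hσ', linkSlice_assemble F hσ' (hFW σ'), linkSlice_zero]
    by_cases h' : σ' = σ
    · rw [h', hFσ, hf0]
    · rw [show F σ' = 0 from if_neg h', map_zero])
  refine ⟨linkSlice W g σ, ?_, ?_⟩
  · have := supportedOn_linkSlice hL hg hσ
    rwa [Nat.sub_add_comm hc] at this
  · rw [bd_linkSlice _ hσ, hgf, linkSlice_assemble F hσ (hFW σ), hFσ]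

end Slices

section BaseChange

theorem exactAt_extension_iff {k : Type} [Field k] {K : Type} [Field K] [Algebra k K]
    {L : Finset (Finset V)} (z : V → k) (n : ℕ) :
    ExactAt K L (fun v => algebraMap k K (z v)) n ↔ ExactAt k L z n := by
  constructor
  · intro h f hf hf0
    obtain ⟨π, hπ⟩ := LinearMap.exists_leftInverse_of_injective (Algebra.linearMap k K)
      (LinearMap.ker_eq_bot.2 (algebraMap k K).injective)
    obtain ⟨g, hg, hgf⟩ := h (fun σ => Algebra.linearMap k K (f σ))
      (fun σ hσ => by simp [hf σ hσ])
      (by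
        rw [bd_algebraMap, bd_map, hf0]
        funext τ
        simp)
    refine ⟨fun σ => π (g σ), fun σ hσ => by simp [hg σ hσ], ?_⟩
    rw [bd_algebraMap] at hgf
    rw [bd_map, hgf]
    funext τ
    exact LinearMap.congr_fun hπ (f τ)
  · intro h f hf hf0
    rw [bd_algebraMap] at hf0
    let b := Module.Basis.ofVectorSpace k K
    have hex : ∀ j, ∃ g : Finset V → k, SupportedOn L (n + 1) g ∧
        bd z g = fun σ => b.coord j (f σ) := by
      intro j
      refine h _ (fun σ hσ => by simp [hf σ hσ]) ?_
      rw [bd_map, hf0]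
      funext τ
      simp
    choose g hg hgf using hex
    classical
    let S := Finset.univ.biUnion fun σ => (b.repr (f σ)).support
    have hterm : ∀ j τ, bd z (fun σ => LinearMap.toSpanSingleton k K (b j) (g j σ)) τ =
        b.repr (f τ) j • b j := by
      intro j τ
      rw [bd_map, hgf]
      simp
    refine ⟨∑ j ∈ S, fun σ => LinearMap.toSpanSingleton k K (b j) (g j σ), ?_, ?_⟩
    · intro σ hσ
      rw [Finset.sum_apply]
      exact Finset.sum_eq_zero fun j _ => by rw [hg j σ hσ, map_zero]
    · rw [bd_algebraMap, map_sum]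
      funext τ
      rw [Finset.sum_apply]
      rw [Finset.sum_congr rfl fun j _ => hterm j τ]
      conv_rhs => rw [← b.linearCombination_repr (f τ), Finsupp.linearCombination_apply]
      refine (Finset.sum_subset (Finset.subset_biUnion_of_mem
        (fun σ => (b.repr (f σ)).support) (Finset.mem_univ τ)) fun j _ hj => ?_).symm
      rw [Finsupp.notMem_support_iff.1 hj, zero_smul]

variable {A : Type} [CommRing A] {L : Finset (Finset V)}

theorem smul_mk_eq_zero_iff (z : V → A) {n : ℕ} (a : A) (F : cyc A L z n) :
    a • (Submodule.Quotient.mk F : twHomology A L z n) = 0 ↔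
      a • F.1 ∈ LinearMap.range (tB A L z n) := by
  rw [← Submodule.Quotient.mk_smul, Submodule.Quotient.mk_eq_zero, Submodule.mem_comap]
  rfl

theorem extendFace_smul {n : ℕ} (a : A) (F : Face L n → A) :
    extendFace (a • F) = a • extendFace F := by
  funext σ
  simp only [extendFace, Pi.smul_apply]
  split_ifs <;> simp

/-- A chain over the fraction field is a multiple of a chain over the ring. -/
theorem exists_clear_denominators [IsDomain A] (K : Type) [Field K] [Algebra A K] [IsFractionRing A K]
    (f : Finset V → K) : ∃ a : A, a ≠ 0 ∧ ∃ g : Finset V → A,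
      ∀ σ, algebraMap A K (g σ) = algebraMap A K a * f σ := by
  obtain ⟨b, hb⟩ := IsLocalization.exist_integer_multiples_of_finite (nonZeroDivisors A) f
  choose g hg using hb
  refine ⟨b, nonZeroDivisors.coe_ne_zero b, g, fun σ => ?_⟩
  rw [hg σ]
  exact Algebra.smul_def _ _

theorem isTorsion_twHomology_iff [IsDomain A] (K : Type) [Field K] [Algebra A K] [IsFractionRing A K]
    (hL : IsCx L) (z : V → A) (n : ℕ) :
    Module.IsTorsion A (twHomology A L z n) ↔
      ExactAt K L (fun v => algebraMap A K (z v)) n := by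
  have hinj : Function.Injective (algebraMap A K) := IsFractionRing.injective A K
  have hne : ∀ {a : A}, a ≠ 0 → algebraMap A K a ≠ 0 := fun ha =>
    (map_ne_zero_iff _ hinj).2 ha
  have hmap : ∀ f : Finset V → A, bd z (fun σ => algebraMap A K (f σ)) =
      fun σ => algebraMap A K (bd z f σ) := bd_map z (Algebra.linearMap A K)
  have hmul : ∀ (c : K) (f : Finset V → K), bd z (fun σ => c * f σ) =
      fun σ => c * bd z f σ := fun c => bd_map z (LinearMap.mulLeft A c)
  constructor
  · intro h f hf hf0
    rw [bd_algebraMap] at hf0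
    obtain ⟨b, hb, f₀, hf₀⟩ := exists_clear_denominators (A := A) K f
    have hs : SupportedOn L n f₀ := fun σ hσ => hinj (by rw [hf₀, hf σ hσ, mul_zero, map_zero])
    have hz : bd z f₀ = 0 := by
      funext τ
      apply hinj
      have := congrFun (hmap f₀) τ
      simp only [hf₀, hmul, hf0] at this
      simpa using this.symm
    have hext := extendFace_restrictFace hs
    obtain ⟨a, ha⟩ := @h (Submodule.Quotient.mk ⟨restrictFace L n f₀,
      (mem_cyc_iff hL z _).2 (by rw [hext, hz])⟩)
    obtain ⟨g, hg, hgf⟩ := (mem_range_tB_iff hL z _).1 ((smul_mk_eq_zero_iff z (a : A) _).1 ha)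
    rw [extendFace_smul, hext] at hgf
    have ha' := hne (nonZeroDivisors.coe_ne_zero a)
    have hb' := hne hb
    refine ⟨fun σ => (algebraMap A K a * algebraMap A K b)⁻¹ * algebraMap A K (g σ),
      fun σ hσ => by simp [hg σ hσ], ?_⟩
    rw [bd_algebraMap, hmul, hmap, hgf]
    funext τ
    simp only [Pi.smul_apply, smul_eq_mul, map_mul, hf₀]
    field_simp
  · intro h x
    obtain ⟨F, rfl⟩ := Submodule.Quotient.mk_surjective _ x
    have hF := (mem_cyc_iff hL z F.1).1 F.2
    obtain ⟨g, hg, hgf⟩ := h (fun σ => algebraMap A K (extendFace F.1 σ))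
      (fun σ hσ => by simp [supportedOn_extendFace F.1 σ hσ])
      (by
        rw [bd_algebraMap, hmap, hF]
        funext τ
        simp)
    rw [bd_algebraMap] at hgf
    obtain ⟨b, hb, g₀, hg₀⟩ := exists_clear_denominators (A := A) K g
    refine ⟨⟨b, mem_nonZeroDivisors_of_ne_zero hb⟩, (smul_mk_eq_zero_iff z b F).2 ?_⟩
    refine (mem_range_tB_iff hL z _).2
      ⟨g₀, fun σ hσ => hinj (by rw [hg₀, hg σ hσ, mul_zero, map_zero]), ?_⟩
    rw [extendFace_smul]
    funext τ
    apply hinj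
    have := congrFun (hmap g₀) τ
    simp only [hg₀, hmul, hgf] at this
    rw [← this, Pi.smul_apply, smul_eq_mul, map_mul]

end BaseChange

section LaurentTorsion

open LaurentPolynomial

variable {k : Type} [Field k]

theorem isIntegral_map_T_one {B : Type} [CommRing B] [Algebra k B] (φ : k[T;T⁻¹] →ₐ[k] B)
    {a : k[T;T⁻¹]} (ha : a ≠ 0) (hφ : φ a = 0) : IsIntegral k (φ (T 1)) := by
  obtain ⟨n, q, hq⟩ := a.exists_T_pow
  refine IsAlgebraic.isIntegral ⟨q, ?_, ?_⟩
  · rintro rfl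
    rw [map_zero] at hq
    exact mul_ne_zero ha (isUnit_T (R := k) n).ne_zero hq.symm
  · have h : Polynomial.aeval (T 1 : k[T;T⁻¹]) q = Polynomial.toLaurentAlg q :=
      DFunLike.congr_fun (Polynomial.algHom_ext (by simp) :
        Polynomial.aeval (T 1 : k[T;T⁻¹]) = Polynomial.toLaurentAlg) q
    rw [Polynomial.aeval_algHom_apply, h, Polynomial.toLaurentAlg_apply, hq, map_mul, hφ,
      zero_mul]

theorem isIntegral_map_T {B : Type} [CommRing B] [Algebra k B] (φ : k[T;T⁻¹] →ₐ[k] B)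
    {a : k[T;T⁻¹]} (ha : a ≠ 0) (hφ : φ a = 0) (n : ℤ) : IsIntegral k (φ (T n)) := by
  obtain ⟨n, rfl | rfl⟩ := n.eq_nat_or_neg
  · rw [← mul_one (n : ℤ), ← T_pow, map_pow]
    exact (isIntegral_map_T_one φ ha hφ).pow n
  · have h := isIntegral_map_T_one (φ.comp (invert (R := k)).toAlgHom) (a := invert a)
      ((map_ne_zero_iff _ invert.injective).2 ha)
      ((congrArg φ (involutive_invert a)).trans hφ)
    have hT : φ.comp (invert (R := k)).toAlgHom (T 1) = φ (T (-1)) := congrArg φ (invert_T 1)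
    rw [hT] at h
    rw [← mul_neg_one (n : ℤ), ← T_pow, map_pow]
    exact h.pow n

theorem finite_quotient_laurentPolynomial {I : Ideal k[T;T⁻¹]} (hI : I ≠ ⊥) :
    Module.Finite k (k[T;T⁻¹] ⧸ I) := by
  obtain ⟨a, haI, ha⟩ := Submodule.exists_mem_ne_zero_of_ne_bot hI
  have hT : ∀ n : ℤ, IsIntegral k (Ideal.Quotient.mk I (T n)) :=
    isIntegral_map_T (Ideal.Quotient.mkₐ k I) ha (Ideal.Quotient.eq_zero_iff_mem.2 haI)
  have : Algebra.IsIntegral k (k[T;T⁻¹] ⧸ I) := by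
    refine ⟨fun x => ?_⟩
    obtain ⟨p, rfl⟩ := Ideal.Quotient.mk_surjective x
    induction p using LaurentPolynomial.induction_on' with
    | add p q hp hq => rw [map_add]; exact hp.add hq
    | C_mul_T n c => rw [map_mul]; exact (isIntegral_algebraMap (x := c)).mul (hT n)
  exact Algebra.IsIntegral.finite

variable {H : Type} [AddCommGroup H] [Module k[T;T⁻¹] H] [Module k H]
  [IsScalarTower k k[T;T⁻¹] H]

theorem isTorsion_of_finiteDimensional [Module.Finite k H] : Module.IsTorsion k[T;T⁻¹] H := by
  intro x
  have hnot : ¬Module.Finite k k[T;T⁻¹] := by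
    intro h
    have : Module.Finite k (ℤ →₀ k) :=
      Module.Finite.equiv (AddMonoidAlgebra.coeffLinearEquiv k : k[T;T⁻¹] ≃ₗ[k] (ℤ →₀ k))
    rw [Module.finite_finsupp_iff] at this
    rcases this with h | h | ⟨-, h⟩
    · exact h.false 0
    · exact not_subsingleton k h
    · exact not_finite ℤ
  by_contra hx
  push Not at hx
  refine hnot (Module.Finite.of_injective
    ((LinearMap.toSpanSingleton k[T;T⁻¹] H x).restrictScalars k) ?_)
  rw [injective_iff_map_eq_zero]
  intro a ha
  by_contra h0
  exact hx ⟨a, mem_nonZeroDivisors_of_ne_zero h0⟩ ha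

theorem finiteDimensional_of_isTorsion [Module.Finite k[T;T⁻¹] H] (h : Module.IsTorsion k[T;T⁻¹] H) :
    Module.Finite k H := by
  have key : ∀ N : Submodule k[T;T⁻¹] H, N.FG → (N.restrictScalars k).FG := by
    intro N hN
    induction N, hN using Submodule.fg_induction with
    | singleton x =>
      obtain ⟨a, ha⟩ := @h x
      have := finite_quotient_laurentPolynomial (I := Ideal.span {(a : k[T;T⁻¹])}) (by
        simp)
      let φ : (k[T;T⁻¹] ⧸ Ideal.span {(a : k[T;T⁻¹])}) →ₗ[k[T;T⁻¹]] H :=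
        Submodule.liftQ _ (LinearMap.toSpanSingleton k[T;T⁻¹] H x) (by
          rw [Ideal.span, Submodule.span_singleton_le_iff_mem]
          exact ha)
      have hφ : (Submodule.span k[T;T⁻¹] {x}).restrictScalars k =
          LinearMap.range (φ.restrictScalars k) := by
        rw [LinearMap.range_restrictScalars, Submodule.range_liftQ,
          LinearMap.range_toSpanSingleton]
      rw [hφ]
      rw [LinearMap.range_eq_map]
      exact Module.Finite.fg_top.map _
    | sup N₁ N₂ _ _ h₁ h₂ =>
      rw [Submodule.restrictScalars_sup]
      exact h₁.sup h₂
  exact ⟨by simpa using key ⊤ Module.Finite.fg_top⟩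

end LaurentTorsion

section Assembly

open LaurentPolynomial

variable {k : Type} [Field k] {L : Finset (Finset V)}

theorem T_sub_one_eq_zero_iff (n : ℤ) : (T n - 1 : k[T;T⁻¹]) = 0 ↔ n = 0 := by
  constructor
  · intro h
    rw [sub_eq_zero, ← T_zero] at h
    by_contra hn
    have h1 := congrArg (fun p : k[T;T⁻¹] => p.coeff n) h
    simp only [T_apply, if_true, if_neg (Ne.symm hn)] at h1
    exact one_ne_zero h1
  · rintro rfl
    simp

theorem finiteDimensional_twHomology_iff (hL : IsCx L) (m : V → ℤ) (n : ℕ) :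
    FiniteDimensional k (twHomology k[T;T⁻¹] L (fun v => T (m v) - 1) n) ↔
      ExactAt k L (zW k (Finset.univ.filter fun v => m v ≠ 0)) n := by
  have : IsNoetherianRing k[T;T⁻¹] := Algebra.FiniteType.isNoetherianRing k _
  let K := FractionRing k[T;T⁻¹]
  have htors : FiniteDimensional k (twHomology k[T;T⁻¹] L (fun v => T (m v) - 1) n) ↔
      Module.IsTorsion k[T;T⁻¹] (twHomology k[T;T⁻¹] L (fun v => T (m v) - 1) n) :=
    ⟨fun _ => isTorsion_of_finiteDimensional (k := k), finiteDimensional_of_isTorsion⟩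
  rw [htors, isTorsion_twHomology_iff K hL]
  have hw : ∀ v, algebraMap k[T;T⁻¹] K (T (m v) - 1) = 0 ↔
      algebraMap k K (zW k (Finset.univ.filter fun v => m v ≠ 0) v) = 0 := by
    intro v
    rw [map_eq_zero_iff _ (IsFractionRing.injective k[T;T⁻¹] K), T_sub_one_eq_zero_iff, zW]
    split_ifs with h <;> simpa using h
  exact (exactAt_congr_weights hw n).trans (exactAt_extension_iff _ n)

theorem exactAt_zW_iff (hL : IsCx L) (W : Finset V) (n : ℕ) :
    ExactAt k L (zW k W) n ↔ ∀ σ ∈ L, Disjoint σ W → σ.card ≤ n →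
      reducedBetti k (linkIn L W σ) ((n : ℤ) - 1 - σ.card) = 0 := by
  have key : ∀ σ ∈ L, σ.card ≤ n →
      (reducedBetti k (linkIn L W σ) ((n : ℤ) - 1 - σ.card) = 0 ↔
        ExactAt k (linkIn L W σ) (fun _ => (1 : k)) (n - σ.card)) := by
    intro σ hσ hc
    rw [reducedBetti, if_neg (by omega), twHomDim_eq_zero_iff (isCx_linkIn hL hσ),
      show ((n : ℤ) - 1 - σ.card + 1).toNat = n - σ.card by omega]
  constructor
  · exact fun h σ hσ hd hc => (key σ hσ hc).2 (h.linkIn hL hd hc)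
  · exact fun h => exactAt_zW_of_exactAt_linkIn hL fun σ hσ hd hc =>
      (key σ hσ hc).1 (h σ hσ hd hc)

end Assembly

open LaurentPolynomial in
/-- For the infinite cyclic cover `T_L^χ` determined by weights
`m_v` with `gcd = 1`, and an integer `r ≥ 1`, the following are equivalent:
(1) `dim_k H_i(T_L^χ; k) < ∞` for all `i ≤ r`;
(2) `β_i(k⟨L⟩, V_0(χ)) = 0` for all `1 ≤ i ≤ r`;
(3) `H̃_j(lk_{L_{V_0(χ)}}(σ); k) = 0` for all faces `σ` of `L` disjoint from `V_0(χ)`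
    (including the empty face) and all `−1 ≤ j ≤ r − 1 − |σ|`. -/
theorem statement12 {V : Type} [Fintype V] [LinearOrder V] (k : Type) [Field k]
    (L : Finset (Finset V)) (hL : IsCx L) (hV : ∀ v : V, {v} ∈ L)
    (m : V → ℤ) (hgcd : Finset.univ.gcd m = 1) (r : ℕ) (hr : 1 ≤ r) :
    ((∀ i ≤ r, FiniteDimensional k
        (twHomology (LaurentPolynomial k) L (fun v => T (m v) - 1) i)) ↔
      (∀ i : ℕ, 1 ≤ i → i ≤ r →
        aomotoBettiW k L (Finset.univ.filter (fun v => m v ≠ 0)) i = 0)) ∧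
    ((∀ i : ℕ, 1 ≤ i → i ≤ r →
        aomotoBettiW k L (Finset.univ.filter (fun v => m v ≠ 0)) i = 0) ↔
      (∀ σ ∈ L, Disjoint σ (Finset.univ.filter (fun v => m v ≠ 0)) →
        ∀ j : ℤ, -1 ≤ j → j ≤ (r : ℤ) - 1 - (σ.card : ℤ) →
          reducedBetti k (linkIn L (Finset.univ.filter (fun v => m v ≠ 0)) σ) j = 0)) := by
  set W := Finset.univ.filter (fun v => m v ≠ 0) with hW
  have hzero : ExactAt k L (zW k W) 0 := by
    obtain ⟨v, hv⟩ : ∃ v, m v ≠ 0 := by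
      by_contra! h
      rw [Finset.gcd_eq_zero_iff.2 fun v _ => h v] at hgcd
      exact zero_ne_one hgcd
    exact exactAt_zero_of_vertex (hV v) (by simp [zW, hW, hv])
  have hbetti : (∀ i : ℕ, 1 ≤ i → i ≤ r → aomotoBettiW k L W i = 0) ↔
      ∀ i ≤ r, ExactAt k L (zW k W) i := by
    simp only [aomotoBettiW, aomotoBetti_eq_twHomDim, twHomDim_eq_zero_iff hL]
    refine ⟨fun h i hi => ?_, fun h i _ hi => h i hi⟩
    rcases Nat.eq_zero_or_pos i with rfl | h0
    · exact hzero
    · exact h i h0 hi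
  rw [hbetti]
  refine ⟨forall₂_congr fun i _ => finiteDimensional_twHomology_iff hL m i, ?_⟩
  simp only [exactAt_zW_iff hL]
  constructor
  · intro h σ hσ hd j hj hjr
    have h1 := h (j + 1 + σ.card).toNat (by omega) σ hσ hd (by omega)
    rwa [show ((j + 1 + σ.card).toNat : ℤ) - 1 - σ.card = j by omega] at h1
  · intro h i hi σ hσ hd hc
    exact h σ hσ hd _ (by omega) (by omega)
end

section
/- Let L be a finite simplicial complex on V, k a field, m : V → ℤ weights with gcd 1, Λ = k[t, t^{−1}], γ_v = t^{m_v} − 1, and f ∈ k[t] irreducible with f ≠ t. Define b_v = ord_f(t^{m_v} − 1) if m_v ≠ 0, and set ξ_v = t^{b_v} ∈ S = k[[t]] if m_v ≠ 0 and ξ_v = 0 if m_v = 0. Write H_i(C_•(T_L, Λ_γ)) = Λ^{r_i} ⊕ ⊕_{g irreducible} ⊕_{j≥1}(Λ/g^jΛ)^{e^i_j(g)} and H_i(C_•(T_L, S_ξ)) = S^{ρ_i} ⊕ ⊕_{j≥1}(S/t^jS)^{ε^i_j}. Then r_i = ρ_i and e^i_j(f) = ε^i_j for all i ≥ 0 and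 j ≥ 1; in particular, the multiplicities ε^i_j computed over S do not depend on f beyond the vector (b_v). -/
open Finset

variable {V : Type} [Fintype V] [LinearOrder V]

/-- `ord_f(g) = max{j ≥ 0 : f^j ∣ g}` (for `g ≠ 0` and `f` a non-unit this set is
finite and nonempty). -/
noncomputable def ordf {R : Type} [CommRing R] (f g : R) : ℕ :=
  sSup {j : ℕ | f ^ j ∣ g}

/-- The `f`-primary part (= `f`-power torsion submodule) of a module over a
commutative ring. -/
def fPrimary (R : Type) [CommRing R] (f : R) (M : Type) [AddCommGroup M] [Module R M] :
    Submodule R M where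
  carrier := {x | ∃ n : ℕ, f ^ n • x = 0}
  add_mem' := by
    rintro a b ⟨na, ha⟩ ⟨nb, hb⟩
    refine ⟨na + nb, ?_⟩
    have h1 : f ^ (na + nb) • a = 0 := by rw [pow_add, mul_comm, mul_smul, ha, smul_zero]
    have h2 : f ^ (na + nb) • b = 0 := by rw [pow_add, mul_smul, hb, smul_zero]
    rw [smul_add, h1, h2, add_zero]
  zero_mem' := ⟨0, smul_zero _⟩
  smul_mem' := by
    rintro c x ⟨n, hn⟩
    exact ⟨n, by rw [smul_comm, hn, smul_zero]⟩

/-! ### Matrices homogeneous with respect to weights -/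

section Homogeneous

variable {k : Type} [Field k] {I J K : Type}

/-- A matrix whose entry at `(i, j)` can be nonzero only if `u i ≤ v j`. -/
def IsHomog (u : I → ℕ) (v : J → ℕ) (c : Matrix I J k) : Prop :=
  ∀ i j, c i j ≠ 0 → u i ≤ v j

/-- The matrix over a `k`-algebra `R` obtained from `c` by scaling the entry at `(i, j)` by
`x ^ (w' j - w i)`. -/
def homogenize (R : Type) [CommRing R] [Algebra k R] (x : R) (w : I → ℕ) (w' : J → ℕ)
    (c : Matrix I J k) : Matrix I J R :=
  Matrix.of fun i j => algebraMap k R (c i j) * x ^ (w' j - w i)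

theorem IsHomog.mul [Fintype J] {w : I → ℕ} {w' : J → ℕ} {w'' : K → ℕ} {c : Matrix I J k}
    {d : Matrix J K k} (hc : IsHomog w w' c) (hd : IsHomog w' w'' d) :
    IsHomog w w'' (c * d) := by
  intro i l h
  rw [Matrix.mul_apply] at h
  obtain ⟨j, -, hj⟩ := Finset.exists_ne_zero_of_sum_ne_zero h
  exact (hc i j (left_ne_zero_of_mul hj)).trans (hd j l (right_ne_zero_of_mul hj))

theorem homogenize_mul [Fintype J] (R : Type) [CommRing R] [Algebra k R] (x : R)
    {w : I → ℕ} {w' : J → ℕ} {w'' : K → ℕ} {c : Matrix I J k} {d : Matrix J K k}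
    (hc : IsHomog w w' c) (hd : IsHomog w' w'' d) :
    homogenize R x w w' c * homogenize R x w' w'' d = homogenize R x w w'' (c * d) := by
  ext i l
  simp only [homogenize, Matrix.mul_apply, Matrix.of_apply, map_sum, map_mul, Finset.sum_mul]
  refine Finset.sum_congr rfl fun j _ => ?_
  by_cases h1 : c i j = 0
  · simp [h1]
  by_cases h2 : d j l = 0
  · simp [h2]
  have h3 : w'' l - w i = (w' j - w i) + (w'' l - w' j) := by
    have := hc i j h1
    have := hd j l h2
    omega
  rw [h3, pow_add]
  ring

theorem isHomog_one [DecidableEq I] (w : I → ℕ) : IsHomog w w (1 : Matrix I I k) := by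
  intro i j h
  by_cases hij : i = j
  · rw [hij]
  · exact absurd (Matrix.one_apply_ne hij) h

theorem homogenize_one [DecidableEq I] (R : Type) [CommRing R] [Algebra k R] (x : R)
    (w : I → ℕ) : homogenize R x w w (1 : Matrix I I k) = 1 := by
  ext i j
  by_cases hij : i = j
  · subst hij
    simp [homogenize]
  · simp [homogenize, hij]

theorem homogenize_zero (R : Type) [CommRing R] [Algebra k R] (x : R)
    (w : I → ℕ) (w' : J → ℕ) : homogenize R x w w' (0 : Matrix I J k) = 0 := by
  ext i j
  simp [homogenize]

theorem IsHomog.fromBlocks {I' J' : Type} {w : I → ℕ} {w₁ : I' → ℕ} {w' : J → ℕ}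
    {w₁' : J' → ℕ} {a : Matrix I J k} {b : Matrix I J' k} {c : Matrix I' J k}
    {d : Matrix I' J' k} (ha : IsHomog w w' a) (hb : IsHomog w w₁' b) (hc : IsHomog w₁ w' c)
    (hd : IsHomog w₁ w₁' d) :
    IsHomog (Sum.elim w w₁) (Sum.elim w' w₁') (Matrix.fromBlocks a b c d) := by
  rintro (i | i) (j | j) h
  exacts [ha i j h, hb i j h, hc i j h, hd i j h]

theorem isHomog_zero (w : I → ℕ) (w' : J → ℕ) : IsHomog w w' (0 : Matrix I J k) :=
  fun _ _ h => absurd rfl h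

/-- An invertible homogeneous matrix whose inverse is homogeneous. -/
structure HomogIso (k : Type) [Field k] {I J : Type} [Fintype I] [Fintype J] [DecidableEq I]
    [DecidableEq J] (w : I → ℕ) (w' : J → ℕ) where
  /-- the matrix -/
  mat : Matrix I J k
  /-- its inverse -/
  inv : Matrix J I k
  mat_homog : IsHomog w w' mat
  inv_homog : IsHomog w' w inv
  mat_inv : mat * inv = 1
  inv_mat : inv * mat = 1

namespace HomogIso

variable {w : I → ℕ} {w' : J → ℕ} {w'' : K → ℕ}
  [Fintype I] [Fintype J] [Fintype K] [DecidableEq I] [DecidableEq J] [DecidableEq K]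

/-- Product of invertible homogeneous matrices. -/
def trans (e : HomogIso k w w') (f : HomogIso k w' w'') : HomogIso k w w'' where
  mat := e.mat * f.mat
  inv := f.inv * e.inv
  mat_homog := e.mat_homog.mul f.mat_homog
  inv_homog := f.inv_homog.mul e.inv_homog
  mat_inv := by
    rw [Matrix.mul_assoc, ← Matrix.mul_assoc f.mat, f.mat_inv, Matrix.one_mul, e.mat_inv]
  inv_mat := by
    rw [Matrix.mul_assoc, ← Matrix.mul_assoc e.inv, e.inv_mat, Matrix.one_mul, f.inv_mat]

/-- The inverse matrix. -/
def symm (e : HomogIso k w w') : HomogIso k w' w :=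
  ⟨e.inv, e.mat, e.inv_homog, e.mat_homog, e.inv_mat, e.mat_inv⟩

/-- The permutation matrix of a weight-preserving bijection. -/
def ofEquiv (e : I ≃ J) (h : ∀ i, w i = w' (e i)) : HomogIso k w w' where
  mat := (1 : Matrix J J k).submatrix e id
  inv := (1 : Matrix J J k).submatrix id e
  mat_homog i j hij := by
    rw [h]
    exact isHomog_one w' _ _ hij
  inv_homog j i hij := by
    rw [h]
    exact isHomog_one w' _ _ hij
  mat_inv := by
    ext i j
    simp [Matrix.mul_apply, Matrix.one_apply]
  inv_mat := by
    rw [Matrix.submatrix_mul_equiv _ _ id e id, Matrix.one_mul]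
    rfl

/-- Block-diagonal sum with an identity block. -/
def sumLeft (e : HomogIso k w w') (w₀ : K → ℕ) :
    HomogIso k (Sum.elim w₀ w) (Sum.elim w₀ w') where
  mat := Matrix.fromBlocks 1 0 0 e.mat
  inv := Matrix.fromBlocks 1 0 0 e.inv
  mat_homog := (isHomog_one w₀).fromBlocks (isHomog_zero _ _) (isHomog_zero _ _) e.mat_homog
  inv_homog := (isHomog_one w₀).fromBlocks (isHomog_zero _ _) (isHomog_zero _ _) e.inv_homog
  mat_inv := by simp [Matrix.fromBlocks_multiply, e.mat_inv]
  inv_mat := by simp [Matrix.fromBlocks_multiply, e.inv_mat]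

/-- Block lower unitriangular matrices. -/
def lower (b : Matrix J I k) (hb : IsHomog w' w b) :
    HomogIso k (Sum.elim w w') (Sum.elim w w') where
  mat := Matrix.fromBlocks 1 0 b 1
  inv := Matrix.fromBlocks 1 0 (-b) 1
  mat_homog := (isHomog_one w).fromBlocks (isHomog_zero _ _) hb (isHomog_one w')
  inv_homog := (isHomog_one w).fromBlocks (isHomog_zero _ _)
    (fun i j h => hb i j fun h' => h (by simp [h'])) (isHomog_one w')
  mat_inv := by simp [Matrix.fromBlocks_multiply]
  inv_mat := by simp [Matrix.fromBlocks_multiply]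

/-- Block upper unitriangular matrices. -/
def upper (b : Matrix I J k) (hb : IsHomog w w' b) :
    HomogIso k (Sum.elim w w') (Sum.elim w w') where
  mat := Matrix.fromBlocks 1 b 0 1
  inv := Matrix.fromBlocks 1 (-b) 0 1
  mat_homog := (isHomog_one w).fromBlocks hb (isHomog_zero _ _) (isHomog_one w')
  inv_homog := (isHomog_one w).fromBlocks
    (fun i j h => hb i j fun h' => h (by simp [h'])) (isHomog_zero _ _) (isHomog_one w')
  mat_inv := by simp [Matrix.fromBlocks_multiply]
  inv_mat := by simp [Matrix.fromBlocks_multiply]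

/-- Multiplying the first block by a nonzero scalar. -/
def scaleLeft (w : I → ℕ) (w' : J → ℕ) (s : k) (hs : s ≠ 0) :
    HomogIso k (Sum.elim w w') (Sum.elim w w') where
  mat := Matrix.fromBlocks (s • 1) 0 0 1
  inv := Matrix.fromBlocks (s⁻¹ • 1) 0 0 1
  mat_homog := IsHomog.fromBlocks
    (fun i j h => isHomog_one (k := k) w i j fun h' => h (by simp [h']))
    (isHomog_zero _ _) (isHomog_zero _ _) (isHomog_one w')
  inv_homog := IsHomog.fromBlocks
    (fun i j h => isHomog_one (k := k) w i j fun h' => h (by simp [h']))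
    (isHomog_zero _ _) (isHomog_zero _ _) (isHomog_one w')
  mat_inv := by simp [Matrix.fromBlocks_multiply, smul_smul, hs]
  inv_mat := by simp [Matrix.fromBlocks_multiply, smul_smul, hs]

theorem ofEquiv_mat_mul {I' : Type} (e : I ≃ J) (h : ∀ i, w i = w' (e i)) (c : Matrix J I' k) :
    (ofEquiv e h : HomogIso k w w').mat * c = c.submatrix e id := by
  ext i j
  simp [ofEquiv, Matrix.mul_apply, Matrix.one_apply]

theorem mul_ofEquiv_mat {I' : Type} (e : I ≃ J) (h : ∀ i, w i = w' (e i)) (c : Matrix I' I k) :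
    c * (ofEquiv e h : HomogIso k w w').mat = c.submatrix id e.symm := by
  ext i j
  simp [ofEquiv, Matrix.mul_apply, Matrix.one_apply, ← Equiv.eq_symm_apply]

end HomogIso

/-- A factorization of `c` as a product of an invertible homogeneous matrix, a matrix
`fromBlocks 1 0 0 0`, and an invertible homogeneous matrix. -/
structure HomogSmith {k : Type} [Field k] {I J : Type} [Fintype I] [Fintype J] [DecidableEq I]
    [DecidableEq J] (w : I → ℕ) (w' : J → ℕ) (c : Matrix I J k) where
  /-- index type of the pivots -/
  A : Type
  /-- index type of the remaining rows -/
  B : Type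
  /-- index type of the remaining columns -/
  C : Type
  [fintypeA : Fintype A]
  [fintypeB : Fintype B]
  [fintypeC : Fintype C]
  [decA : DecidableEq A]
  [decB : DecidableEq B]
  [decC : DecidableEq C]
  /-- row weights of the pivots -/
  wA : A → ℕ
  /-- column weights of the pivots -/
  wA' : A → ℕ
  /-- weights of the remaining rows -/
  wB : B → ℕ
  /-- weights of the remaining columns -/
  wC : C → ℕ
  /-- the left factor -/
  left : HomogIso k w (Sum.elim wA wB)
  /-- the right factor -/
  right : HomogIso k (Sum.elim wA' wC) w'
  le : ∀ a, wA a ≤ wA' a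
  eq : c = left.mat * (Matrix.fromBlocks 1 0 0 0 : Matrix (A ⊕ B) (A ⊕ C) k) * right.mat

attribute [instance] HomogSmith.fintypeA HomogSmith.fintypeB HomogSmith.fintypeC
  HomogSmith.decA HomogSmith.decB HomogSmith.decC

namespace HomogSmith

variable [Fintype I] [Fintype J] [DecidableEq I] [DecidableEq J]

/-- Transport of a factorization along invertible homogeneous matrices. -/
def ofIso {I' J' : Type} [Fintype I'] [Fintype J'] [DecidableEq I'] [DecidableEq J']
    {w : I → ℕ} {w' : J → ℕ} {v : I' → ℕ} {v' : J' → ℕ} {c : Matrix I J k}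
    {c' : Matrix I' J' k} (e : HomogIso k w v) (e' : HomogIso k v' w')
    (h : c = e.mat * c' * e'.mat) (s : HomogSmith v v' c') : HomogSmith w w' c where
  A := s.A
  B := s.B
  C := s.C
  wA := s.wA
  wA' := s.wA'
  wB := s.wB
  wC := s.wC
  left := e.trans s.left
  right := s.right.trans e'
  le := s.le
  eq := by
    conv_lhs => rw [h, s.eq]
    simp only [HomogIso.trans, Matrix.mul_assoc]

/-- The factorization of the zero matrix. -/
def zero (w : I → ℕ) (w' : J → ℕ) : HomogSmith w w' (0 : Matrix I J k) where
  A := Empty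
  B := I
  C := J
  wA := Empty.elim
  wA' := Empty.elim
  wB := w
  wC := w'
  left := HomogIso.ofEquiv (Equiv.emptySum Empty I).symm fun _ => rfl
  right := HomogIso.ofEquiv (Equiv.emptySum Empty J) (by rintro (⟨⟨⟩⟩ | _); rfl)
  le := by rintro ⟨⟩
  eq := by
    have : (Matrix.fromBlocks 1 0 0 0 : Matrix (Empty ⊕ I) (Empty ⊕ J) k) = 0 := by
      ext (⟨⟨⟩⟩ | i) (⟨⟨⟩⟩ | j)
      rfl
    rw [this, Matrix.mul_zero, Matrix.zero_mul]

/-- Adjoining a pivot to a factorization. -/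
def consPivot {w : I → ℕ} {w' : J → ℕ} {c : Matrix I J k} (s : HomogSmith w w' c)
    (p p' : Unit → ℕ) (hp : ∀ u, p u ≤ p' u) :
    HomogSmith (Sum.elim p w) (Sum.elim p' w')
      (Matrix.fromBlocks (1 : Matrix Unit Unit k) 0 0 c) where
  A := Unit ⊕ s.A
  B := s.B
  C := s.C
  wA := Sum.elim p s.wA
  wA' := Sum.elim p' s.wA'
  wB := s.wB
  wC := s.wC
  left := (s.left.sumLeft p).trans
    (HomogIso.ofEquiv (Equiv.sumAssoc Unit s.A s.B).symm (by rintro (_ | _ | _) <;> rfl))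
  right := (HomogIso.ofEquiv (Equiv.sumAssoc Unit s.A s.C) (by rintro ((_ | _) | _) <;> rfl)).trans
    (s.right.sumLeft p')
  le := by
    rintro (a | a)
    exacts [hp a, s.le a]
  eq := by
    have h : (HomogIso.ofEquiv (k := k) (w := Sum.elim p (Sum.elim s.wA s.wB))
          (w' := Sum.elim (Sum.elim p s.wA) s.wB) (Equiv.sumAssoc Unit s.A s.B).symm
          (by rintro (_ | _ | _) <;> rfl)).mat *
        (Matrix.fromBlocks 1 0 0 0 : Matrix ((Unit ⊕ s.A) ⊕ s.B) ((Unit ⊕ s.A) ⊕ s.C) k) *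
        (HomogIso.ofEquiv (k := k) (w := Sum.elim (Sum.elim p' s.wA') s.wC)
          (w' := Sum.elim p' (Sum.elim s.wA' s.wC)) (Equiv.sumAssoc Unit s.A s.C)
          (by rintro ((_ | _) | _) <;> rfl)).mat =
        Matrix.fromBlocks 1 0 0 (Matrix.fromBlocks 1 0 0 0) := by
      rw [HomogIso.mul_ofEquiv_mat, HomogIso.ofEquiv_mat_mul]
      ext (_ | _ | _) (_ | _ | _) <;> simp [Matrix.one_apply]
    rw [Matrix.mul_assoc] at h
    simp only [HomogIso.trans]
    rw [Matrix.mul_assoc, Matrix.mul_assoc, ← Matrix.mul_assoc _ _ (s.right.sumLeft p').mat,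
      ← Matrix.mul_assoc _ _ (s.right.sumLeft p').mat, h]
    conv_lhs => rw [s.eq]
    simp [HomogIso.sumLeft, Matrix.fromBlocks_multiply, Matrix.mul_assoc]

end HomogSmith

theorem exists_pivot [Fintype I] [Fintype J] (w : I → ℕ) (w' : J → ℕ) {c : Matrix I J k}
    (hc : c ≠ 0) : ∃ i j, c i j ≠ 0 ∧ ∀ i' j', c i' j' ≠ 0 → w' j - w i ≤ w' j' - w i' := by
  classical
  have hne : (Finset.univ.filter fun p : I × J => c p.1 p.2 ≠ 0).Nonempty := by
    by_contra h
    refine hc (Matrix.ext fun i j => ?_)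
    by_contra h'
    exact h ⟨(i, j), by simpa using h'⟩
  obtain ⟨p, hp, hmin⟩ := Finset.exists_min_image _ (fun p : I × J => w' p.2 - w p.1) hne
  refine ⟨p.1, p.2, by simpa using hp, fun i' j' h => hmin (i', j') (by simpa using h)⟩

/-- Clearing the row and the column of a pivot of minimal weight. -/
theorem nonempty_homogSmith_of_block [Fintype I] [Fintype J] [DecidableEq I] [DecidableEq J]
    {w : I → ℕ} {w' : J → ℕ} {p p' : Unit → ℕ} {c : Matrix (Unit ⊕ I) (Unit ⊕ J) k}
    (hc : IsHomog (Sum.elim p w) (Sum.elim p' w') c) (h0 : c (.inl ()) (.inl ()) ≠ 0)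
    (hmin : ∀ i j, c i j ≠ 0 → p' () - p () ≤ Sum.elim p' w' j - Sum.elim p w i)
    (ih : ∀ c' : Matrix I J k, IsHomog w w' c' → Nonempty (HomogSmith w w' c')) :
    Nonempty (HomogSmith (Sum.elim p w) (Sum.elim p' w') c) := by
  have hp : p () ≤ p' () := hc _ _ h0
  set s := c (.inl ()) (.inl ()) with hs
  have hlow : IsHomog w p (s⁻¹ • c.toBlocks₂₁) := by
    intro i u h
    change w i ≤ p ()
    have h' : c (.inr i) (.inl ()) ≠ 0 := fun h' => h (by simp [Matrix.toBlocks₂₁, h'])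
    have h1 := hc _ _ h'
    have h2 := hmin _ _ h'
    dsimp only [Sum.elim_inl, Sum.elim_inr] at h1 h2 ⊢
    omega
  have hup : IsHomog p' w' (s⁻¹ • c.toBlocks₁₂) := by
    intro u j h
    change p' () ≤ w' j
    have h' : c (.inl ()) (.inr j) ≠ 0 := fun h' => h (by simp [Matrix.toBlocks₁₂, h'])
    have h1 := hc _ _ h'
    have h2 := hmin _ _ h'
    dsimp only [Sum.elim_inl, Sum.elim_inr] at h1 h2 ⊢
    omega
  have hrest : IsHomog w w' (c.toBlocks₂₂ - s⁻¹ • (c.toBlocks₂₁ * c.toBlocks₁₂)) := by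
    intro i j h
    by_cases h' : c (.inr i) (.inr j) = 0
    · have h1 : (s⁻¹ • c.toBlocks₂₁ * c.toBlocks₁₂) i j ≠ 0 := fun h1 => h (by
        rw [Matrix.smul_mul] at h1
        rw [Matrix.sub_apply, h1, sub_zero]
        exact h')
      refine (hlow.mul (w'' := w') ?_) i j h1
      rintro ⟨⟩ l hl
      exact hc (.inl ()) (.inr l) hl
    · exact hc _ _ h'
  obtain ⟨S⟩ := ih _ hrest
  refine ⟨HomogSmith.ofIso
    ((HomogIso.lower _ hlow).trans (HomogIso.scaleLeft p w s h0)) (HomogIso.upper _ hup) ?_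
    (S.consPivot p p' fun _ => hp)⟩
  have h11 : c.toBlocks₁₁ = s • 1 := by
    ext ⟨⟩ ⟨⟩
    simp [Matrix.toBlocks₁₁, hs]
  conv_lhs => rw [← Matrix.fromBlocks_toBlocks c, h11]
  simp [HomogIso.lower, HomogIso.upper, HomogIso.scaleLeft, HomogIso.trans,
    Matrix.fromBlocks_multiply, smul_smul, h0]

theorem nonempty_homogSmith [Fintype I] [Fintype J] [DecidableEq I] [DecidableEq J]
    {w : I → ℕ} {w' : J → ℕ} {c : Matrix I J k} (hc : IsHomog w w' c) :
    Nonempty (HomogSmith w w' c) := by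
  induction hn : Fintype.card I generalizing I J with
  | zero =>
    have := Fintype.card_eq_zero_iff.mp hn
    obtain rfl : c = 0 := Matrix.ext fun i => isEmptyElim i
    exact ⟨HomogSmith.zero w w'⟩
  | succ n ih =>
    by_cases h0 : c = 0
    · rw [h0]
      exact ⟨HomogSmith.zero w w'⟩
    obtain ⟨i, j, hij, hmin⟩ := exists_pivot w w' h0
    let eI : Unit ⊕ {i' // i' ≠ i} ≃ I :=
      (Equiv.sumComm _ _).trans ((Equiv.optionEquivSumPUnit _).symm.trans (Equiv.optionSubtypeNe i))
    let eJ : Unit ⊕ {j' // j' ≠ j} ≃ J :=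
      (Equiv.sumComm _ _).trans ((Equiv.optionEquivSumPUnit _).symm.trans (Equiv.optionSubtypeNe j))
    have hwI : ∀ a, w (eI a) = Sum.elim (fun _ : Unit => w i) (fun i' => w i'.1) a := by
      rintro (_ | _) <;> simp [eI]
    have hwJ : ∀ a, w' (eJ a) = Sum.elim (fun _ : Unit => w' j) (fun j' => w' j'.1) a := by
      rintro (_ | _) <;> simp [eJ]
    have hcard : Fintype.card {i' // i' ≠ i} = n := by
      rw [Fintype.card_subtype_compl]
      simp [hn]
    have key := nonempty_homogSmith_of_block (c := c.submatrix eI eJ)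
      (p := fun _ => w i) (p' := fun _ => w' j) (w := fun i' : {i' // i' ≠ i} => w i'.1)
      (w' := fun j' : {j' // j' ≠ j} => w' j'.1)
      (fun a b h => by rw [← hwI, ← hwJ]; exact hc _ _ h)
      (by simpa [eI, eJ] using hij)
      (fun a b h => by rw [← hwI, ← hwJ]; exact hmin _ _ h)
      (fun c' hc' => ih hc' hcard)
    obtain ⟨S⟩ := key
    refine ⟨HomogSmith.ofIso (HomogIso.ofEquiv eI.symm fun a => ?_)
      (HomogIso.ofEquiv eJ fun a => (hwJ a).symm) ?_ S⟩
    · rw [← hwI, Equiv.apply_symm_apply]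
    · rw [HomogIso.mul_ofEquiv_mat, HomogIso.ofEquiv_mat_mul]
      ext a b
      simp

/-- The specialization of an invertible homogeneous matrix. -/
def HomogIso.eval [Fintype I] [Fintype J] [DecidableEq I] [DecidableEq J] {w : I → ℕ}
    {w' : J → ℕ} (e : HomogIso k w w') (R : Type) [CommRing R] [Algebra k R] (x : R) :
    Matrix I J R :=
  homogenize R x w w' e.mat

theorem HomogIso.eval_mulVec_symm [Fintype I] [Fintype J] [DecidableEq I] [DecidableEq J]
    {w : I → ℕ} {w' : J → ℕ} (e : HomogIso k w w') (R : Type) [CommRing R] [Algebra k R] (x : R)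
    (y : I → R) : (e.eval R x).mulVec ((e.symm.eval R x).mulVec y) = y := by
  rw [Matrix.mulVec_mulVec]
  simp only [eval, symm]
  rw [homogenize_mul R x e.mat_homog e.inv_homog, e.mat_inv, homogenize_one, Matrix.one_mulVec]

theorem HomogIso.symm_eval_mulVec [Fintype I] [Fintype J] [DecidableEq I] [DecidableEq J]
    {w : I → ℕ} {w' : J → ℕ} (e : HomogIso k w w') (R : Type) [CommRing R] [Algebra k R] (x : R)
    (y : J → R) : (e.symm.eval R x).mulVec ((e.eval R x).mulVec y) = y :=
  e.symm.eval_mulVec_symm R x y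

theorem HomogIso.eval_mulVec_eq_zero_iff [Fintype I] [Fintype J] [DecidableEq I] [DecidableEq J]
    {w : I → ℕ} {w' : J → ℕ} (e : HomogIso k w w') (R : Type) [CommRing R] [Algebra k R] (x : R)
    (y : J → R) : (e.eval R x).mulVec y = 0 ↔ y = 0 := by
  refine ⟨fun h => ?_, fun h => by rw [h, Matrix.mulVec_zero]⟩
  rw [← e.symm_eval_mulVec R x y, h, Matrix.mulVec_zero]

theorem isHomog_smithBlock {A B C : Type} [DecidableEq A] {wA wA' : A → ℕ} (wB : B → ℕ)
    (wC : C → ℕ) (h : ∀ a, wA a ≤ wA' a) :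
    IsHomog (Sum.elim wA wB) (Sum.elim wA' wC)
      (Matrix.fromBlocks 1 0 0 0 : Matrix (A ⊕ B) (A ⊕ C) k) := by
  refine IsHomog.fromBlocks (fun a a' haa' => ?_) (isHomog_zero _ _) (isHomog_zero _ _)
    (isHomog_zero _ _)
  by_cases hij : a = a'
  · rw [← hij]
    exact h a
  · exact absurd (Matrix.one_apply_ne hij) haa'

theorem homogenize_smithBlock_mulVec {A B C : Type} [DecidableEq A] [Fintype A] [Fintype C]
    {wA wA' : A → ℕ} {wB : B → ℕ} {wC : C → ℕ} (R : Type) [CommRing R] [Algebra k R]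
    (x : R) (y : A ⊕ C → R) :
    (homogenize R x (Sum.elim wA wB) (Sum.elim wA' wC)
      (Matrix.fromBlocks 1 0 0 0 : Matrix (A ⊕ B) (A ⊕ C) k)).mulVec y =
    Sum.elim (fun a => x ^ (wA' a - wA a) * y (.inl a)) 0 := by
  ext (a | b)
  · simp [homogenize, Matrix.mulVec, dotProduct, Matrix.one_apply]
  · simp [homogenize, Matrix.mulVec, dotProduct]

theorem HomogSmith.mulVec_eq [Fintype I] [Fintype J] [DecidableEq I] [DecidableEq J]
    {w : I → ℕ} {w' : J → ℕ} {c : Matrix I J k} (s : HomogSmith w w' c) (R : Type) [CommRing R]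
    [Algebra k R] (x : R) (y : J → R) :
    (homogenize R x w w' c).mulVec y =
      (s.left.eval R x).mulVec
        (Sum.elim (fun a => x ^ (s.wA' a - s.wA a) *
          (s.right.eval R x).mulVec y (.inl a)) 0) := by
  have h := isHomog_smithBlock (k := k) s.wB s.wC s.le
  conv_lhs => rw [s.eq, ← homogenize_mul R x (s.left.mat_homog.mul h) s.right.mat_homog,
    ← homogenize_mul R x s.left.mat_homog h, ← Matrix.mulVec_mulVec, ← Matrix.mulVec_mulVec,
    homogenize_smithBlock_mulVec]
  rfl

theorem HomogSmith.mulVec_eq_zero_iff [Fintype I] [Fintype J] [DecidableEq I] [DecidableEq J]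
    {w : I → ℕ} {w' : J → ℕ} {c : Matrix I J k} (s : HomogSmith w w' c) (R : Type) [CommRing R]
    [IsDomain R] [Algebra k R] {x : R} (hx : x ≠ 0) (y : J → R) :
    (homogenize R x w w' c).mulVec y = 0 ↔
      ∀ a, (s.right.eval R x).mulVec y (.inl a) = 0 := by
  rw [s.mulVec_eq, s.left.eval_mulVec_eq_zero_iff]
  constructor
  · intro h a
    simpa [hx] using congrFun h (.inl a)
  · intro h
    ext (a | b)
    · simp [h]
    · rfl

theorem HomogSmith.mem_range_iff [Fintype I] [Fintype J] [DecidableEq I] [DecidableEq J]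
    {w : I → ℕ} {w' : J → ℕ} {c : Matrix I J k} (s : HomogSmith w w' c) (R : Type) [CommRing R]
    [Algebra k R] (x : R) (y : I → R) :
    y ∈ LinearMap.range (homogenize R x w w' c).mulVecLin ↔
      (∀ a, x ^ (s.wA' a - s.wA a) ∣ (s.left.symm.eval R x).mulVec y (.inl a)) ∧
      ∀ b, (s.left.symm.eval R x).mulVec y (.inr b) = 0 := by
  constructor
  · rintro ⟨z, rfl⟩
    rw [Matrix.mulVecLin_apply, s.mulVec_eq, s.left.symm_eval_mulVec]
    exact ⟨fun a => ⟨_, rfl⟩, fun b => rfl⟩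
  · rintro ⟨h1, h2⟩
    choose z hz using h1
    refine ⟨(s.right.symm.eval R x).mulVec (Sum.elim z 0), ?_⟩
    rw [Matrix.mulVecLin_apply, s.mulVec_eq, s.right.eval_mulVec_symm]
    rw [← s.left.eval_mulVec_symm R x y]
    congr 1
    ext (a | b)
    · simp [hz]
    · simp [h2]

/-- The homology of a homogeneous complex decomposes uniformly over all `k`-domains `R` and all
nonzero specializations `x : R` of the variable. -/
theorem exists_homology_decomposition [Fintype I] [Fintype J] [Finite K]
    {w : I → ℕ} {w' : J → ℕ} {w₀ : K → ℕ} {c : Matrix I J k} {d : Matrix K I k}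
    (hc : IsHomog w w' c) (hd : IsHomog w₀ w d) (hdc : d * c = 0) :
    ∃ (r n : ℕ) (a : Fin n → ℕ), (∀ j, 1 ≤ a j) ∧
      ∀ (R : Type) [CommRing R] [IsDomain R] [Algebra k R] (x : R), x ≠ 0 →
        Nonempty ((LinearMap.ker (homogenize R x w₀ w d).mulVecLin ⧸
            (LinearMap.range (homogenize R x w w' c).mulVecLin).comap
              (LinearMap.ker (homogenize R x w₀ w d).mulVecLin).subtype) ≃ₗ[R]
          (Fin r → R) × (Π j, R ⧸ Ideal.span {x ^ a j})) := by
  classical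
  have := Fintype.ofFinite K
  obtain ⟨s⟩ := nonempty_homogSmith hc
  set d' := d * s.left.mat with hd'
  have hd'_homog : IsHomog w₀ (Sum.elim s.wA s.wB) d' := hd.mul s.left.mat_homog
  have hd'0 : d' * (Matrix.fromBlocks 1 0 0 0 : Matrix (s.A ⊕ s.B) (s.A ⊕ s.C) k) = 0 := by
    have h : d' * (Matrix.fromBlocks 1 0 0 0 : Matrix (s.A ⊕ s.B) (s.A ⊕ s.C) k) =
        d * (s.left.mat * (Matrix.fromBlocks 1 0 0 0 : Matrix (s.A ⊕ s.B) (s.A ⊕ s.C) k) *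
          s.right.mat) * s.right.inv := by
      simp only [hd', Matrix.mul_assoc, s.right.mat_inv, Matrix.mul_one]
    rw [h, ← s.eq, hdc, Matrix.zero_mul]
  have hd'A : ∀ i a, d' i (.inl a) = 0 := by
    intro i a
    have := congrFun (congrFun hd'0 i) (.inl a)
    simpa [Matrix.mul_apply, Matrix.one_apply] using this
  have he : IsHomog w₀ s.wB (d'.submatrix id Sum.inr) := fun i b h => hd'_homog i (.inr b) h
  obtain ⟨s'⟩ := nonempty_homogSmith he
  let P := {a : s.A // 1 ≤ s.wA' a - s.wA a}
  let eP : P ≃ Fin (Fintype.card P) := Fintype.equivFin P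
  let eC : s'.C ≃ Fin (Fintype.card s'.C) := Fintype.equivFin s'.C
  refine ⟨Fintype.card s'.C, Fintype.card P,
    fun j => s.wA' (eP.symm j).1 - s.wA (eP.symm j).1, fun j => (eP.symm j).2, ?_⟩
  intro R _ _ _ x hx
  -- coordinates adapted to both factorizations
  let pr : (I → R) →ₗ[R] (s.A ⊕ s.B → R) := (s.left.symm.eval R x).mulVecLin
  let prB : (I → R) →ₗ[R] (s'.A ⊕ s'.C → R) :=
    (s'.right.eval R x).mulVecLin ∘ₗ LinearMap.funLeft R R Sum.inr ∘ₗ pr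
  let Φ : (I → R) →ₗ[R] (Fin (Fintype.card s'.C) → R) ×
      (Π j, R ⧸ Ideal.span {x ^ (s.wA' (eP.symm j).1 - s.wA (eP.symm j).1)}) :=
    (LinearMap.funLeft R R (fun j => Sum.inr (eC.symm j)) ∘ₗ prB).prod
      (LinearMap.pi fun j => (Submodule.mkQ _) ∘ₗ LinearMap.proj (.inl (eP.symm j).1) ∘ₗ pr)
  have hker : ∀ y, y ∈ LinearMap.ker (homogenize R x w₀ w d).mulVecLin ↔
      ∀ a, prB y (.inl a) = 0 := by
    intro y
    have h1 : (homogenize R x w₀ w d).mulVec y =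
        (homogenize R x w₀ s.wB (d'.submatrix id Sum.inr)).mulVec
          (fun b => pr y (.inr b)) := by
      conv_lhs => rw [← s.left.eval_mulVec_symm R x y, Matrix.mulVec_mulVec, HomogIso.eval,
        homogenize_mul R x hd s.left.mat_homog]
      ext i
      simp only [Matrix.mulVec, dotProduct, Fintype.sum_sum_type, homogenize, Matrix.of_apply]
      rw [Finset.sum_eq_zero, zero_add]
      · rfl
      · intro a _
        rw [← hd', hd'A, map_zero, zero_mul, zero_mul]
    rw [LinearMap.mem_ker, Matrix.mulVecLin_apply, h1, s'.mulVec_eq_zero_iff R hx]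
    rfl
  let Ψ := Φ ∘ₗ (LinearMap.ker (homogenize R x w₀ w d).mulVecLin).subtype
  have hΨker : LinearMap.ker Ψ = (LinearMap.range (homogenize R x w w' c).mulVecLin).comap
      (LinearMap.ker (homogenize R x w₀ w d).mulVecLin).subtype := by
    ext ⟨y, hy⟩
    rw [hker] at hy
    rw [Submodule.mem_comap, Submodule.subtype_apply, s.mem_range_iff, LinearMap.mem_ker]
    have h2 : Ψ ⟨y, (hker y).mpr hy⟩ = 0 ↔ (∀ j, prB y (.inr (eC.symm j)) = 0) ∧
        ∀ j, x ^ (s.wA' (eP.symm j).1 - s.wA (eP.symm j).1) ∣ pr y (.inl (eP.symm j).1) := by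
      rw [Prod.ext_iff, funext_iff, funext_iff]
      refine and_congr Iff.rfl (forall_congr' fun j => ?_)
      rw [← Ideal.mem_span_singleton]
      exact Submodule.Quotient.mk_eq_zero _
    have h3 : (∀ b, pr y (.inr b) = 0) ↔ ∀ j, prB y (.inr (eC.symm j)) = 0 := by
      have h4 := s'.right.eval_mulVec_eq_zero_iff R x (fun b => pr y (.inr b))
      refine (funext_iff (g := (0 : s.B → R))).symm.trans
        (h4.symm.trans ⟨fun h j => congrFun h _, fun h => ?_⟩)
      ext (a | b)
      · exact hy a
      · have := h (eC b)
        rwa [Equiv.symm_apply_apply] at this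
    rw [h2, ← h3, and_comm]
    refine and_congr ⟨fun h a => ?_, fun h j => h _⟩ Iff.rfl
    by_cases ha : 1 ≤ s.wA' a - s.wA a
    · have := h (eP ⟨a, ha⟩)
      rwa [Equiv.symm_apply_apply] at this
    · rw [Nat.lt_one_iff.mp (not_le.mp ha), pow_zero]
      exact one_dvd _
  have hΨsurj : Function.Surjective Ψ := by
    rintro ⟨p, q⟩
    have hq : ∀ j, ∃ z, Submodule.Quotient.mk z = q j :=
      fun j => Submodule.Quotient.mk_surjective _ (q j)
    choose z hz using hq
    let yB : s.B → R := (s'.right.symm.eval R x).mulVec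
      (Sum.elim (0 : s'.A → R) fun b => p (eC b))
    let y : I → R := (s.left.eval R x).mulVec
      (Sum.elim (fun a => if h : 1 ≤ s.wA' a - s.wA a then z (eP ⟨a, h⟩) else 0) yB)
    have hpr : pr y = Sum.elim
        (fun a => if h : 1 ≤ s.wA' a - s.wA a then z (eP ⟨a, h⟩) else 0) yB :=
      s.left.symm_eval_mulVec R x _
    have hprB : prB y = Sum.elim (0 : s'.A → R) (fun b => p (eC b)) := by
      have : prB y = (s'.right.eval R x).mulVec (fun b => pr y (.inr b)) := rfl
      rw [this, hpr]
      exact s'.right.eval_mulVec_symm R x _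
    refine ⟨⟨y, (hker y).mpr fun a => by rw [hprB]; rfl⟩, Prod.ext ?_ ?_⟩
    · ext j
      change prB y (.inr (eC.symm j)) = p j
      rw [hprB]
      simp
    · ext j
      change Submodule.Quotient.mk (pr y (.inl (eP.symm j).1)) = q j
      rw [hpr, ← hz j]
      have := (eP.symm j).2
      simp [this]
  exact ⟨(Submodule.quotEquivOfEq _ _ hΨker.symm).trans (Ψ.quotKerEquivOfSurjective hΨsurj)⟩

end Homogeneous

/-! ### Maps that are mutually inverse up to a scalar -/

section UpToScalar

variable {R : Type} [CommRing R] {M N : Type} [AddCommGroup M] [Module R M] [AddCommGroup N]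
  [Module R N]

/-- The map induced on subquotients by a linear map. -/
def subquotientMap (φ : M →ₗ[R] N) {Z B : Submodule R M} {Z' B' : Submodule R N}
    (hZ : ∀ y ∈ Z, φ y ∈ Z') (hB : ∀ y ∈ B, φ y ∈ B') :
    (Z ⧸ B.comap Z.subtype) →ₗ[R] (Z' ⧸ B'.comap Z'.subtype) :=
  Submodule.mapQ _ _ (φ.restrict hZ) fun y hy => hB y hy

theorem subquotientMap_subquotientMap {φ : M →ₗ[R] N} {ψ : N →ₗ[R] M} {Z B : Submodule R M}
    {Z' B' : Submodule R N} (hZ : ∀ y ∈ Z, φ y ∈ Z') (hB : ∀ y ∈ B, φ y ∈ B')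
    (hZ' : ∀ y ∈ Z', ψ y ∈ Z) (hB' : ∀ y ∈ B', ψ y ∈ B) {u : R} (h : ∀ y, ψ (φ y) = u • y)
    (y : Z ⧸ B.comap Z.subtype) :
    subquotientMap ψ hZ' hB' (subquotientMap φ hZ hB y) = u • y := by
  obtain ⟨y, rfl⟩ := Submodule.Quotient.mk_surjective _ y
  change Submodule.Quotient.mk _ = _
  rw [← Submodule.Quotient.mk_smul]
  exact congrArg _ (Subtype.ext (h y.1))

theorem eq_zero_of_isCoprime_smul {f u : R} (hu : IsCoprime u f) {n : ℕ} {y : M}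
    (hf : f ^ n • y = 0) (hy : u • y = 0) : y = 0 := by
  obtain ⟨a, b, hab⟩ := hu.pow_right (n := n)
  rw [← one_smul R y, ← hab, add_smul, mul_smul, mul_smul, hf, hy, smul_zero, smul_zero, add_zero]

/-- Maps that are mutually inverse up to a scalar coprime to `f` identify `f`-primary parts. -/
theorem nonempty_fPrimary_equiv {f u : R} (hu : IsCoprime u f) (g : M →ₗ[R] N) (h : N →ₗ[R] M)
    (hg : ∀ y, h (g y) = u • y) (hh : ∀ y, g (h y) = u • y) :
    Nonempty (fPrimary R f M ≃ₗ[R] fPrimary R f N) := by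
  have hmap : ∀ y ∈ fPrimary R f M, g y ∈ fPrimary R f N := by
    rintro y ⟨n, hn⟩
    exact ⟨n, by rw [← map_smul, hn, map_zero]⟩
  refine ⟨LinearEquiv.ofBijective (g.restrict hmap) ⟨?_, ?_⟩⟩
  · rw [← LinearMap.ker_eq_bot, LinearMap.ker_eq_bot']
    rintro ⟨y, n, hn⟩ hy
    have hy' : g y = 0 := congrArg Subtype.val hy
    exact Subtype.ext (eq_zero_of_isCoprime_smul hu hn (by rw [← hg, hy', map_zero]))
  · rintro ⟨y, n, hn⟩
    obtain ⟨a, b, hab⟩ := hu.pow_right (n := n)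
    refine ⟨⟨a • h y, n, ?_⟩, Subtype.ext ?_⟩
    · rw [smul_comm, ← map_smul, hn, map_zero, smul_zero]
    · change g (a • h y) = y
      rw [map_smul, hh]
      conv_rhs => rw [← one_smul R y, ← hab, add_smul, mul_smul, mul_smul, hn, smul_zero, add_zero]

theorem rank_le_of_comp_eq_smul [IsDomain R] {u : R} (hu : u ≠ 0) (g : M →ₗ[R] N)
    (h : N →ₗ[R] M) (hg : ∀ y, h (g y) = u • y) : Module.rank R M ≤ Module.rank R N := by
  rw [Module.rank_def]
  refine ciSup_le' fun s => ?_
  refine LinearIndependent.cardinal_le_rank (v := fun i : s.1 => g i) ?_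
  have hs : LinearIndependent R (fun i : s.1 => (i : M)) := s.2
  rw [linearIndependent_iff'] at hs ⊢
  intro t c hc i hi
  have h1 : ∑ i ∈ t, (u * c i) • (i : M) = 0 := by
    have := congrArg h hc
    rw [map_sum, map_zero] at this
    rw [← this]
    refine Finset.sum_congr rfl fun j _ => ?_
    rw [map_smul, hg, smul_smul, mul_comm]
  exact (mul_eq_zero.mp (hs t (fun i => u * c i) h1 i hi)).resolve_left hu

theorem pow_sum_smul_pi_quotient {f : R} {n : ℕ} (a : Fin n → ℕ)
    (q : Π j, R ⧸ Ideal.span {f ^ a j}) : f ^ (∑ j, a j) • q = 0 := by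
  ext j
  obtain ⟨z, hz⟩ := Submodule.Quotient.mk_surjective _ (q j)
  rw [Pi.smul_apply, ← hz, ← Submodule.Quotient.mk_smul]
  refine (Submodule.Quotient.mk_eq_zero _).mpr (Ideal.mem_span_singleton.mpr ?_)
  exact (pow_dvd_pow f (Finset.single_le_sum (fun _ _ => Nat.zero_le _)
    (Finset.mem_univ j))).mul_right z

theorem nonempty_fPrimary_free_prod [IsDomain R] {f : R} (hf : f ≠ 0) (r : ℕ) {n : ℕ}
    (a : Fin n → ℕ) :
    Nonempty (fPrimary R f ((Fin r → R) × (Π j, R ⧸ Ideal.span {f ^ a j})) ≃ₗ[R]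
      (Π j, R ⧸ Ideal.span {f ^ a j})) := by
  have hmem : ∀ q, LinearMap.inr R (Fin r → R) (Π j, R ⧸ Ideal.span {f ^ a j}) q ∈
      fPrimary R f ((Fin r → R) × (Π j, R ⧸ Ideal.span {f ^ a j})) := fun q =>
    ⟨∑ j, a j, by rw [← map_smul, pow_sum_smul_pi_quotient, map_zero]⟩
  refine ⟨(LinearEquiv.ofBijective ((LinearMap.inr R _ _).codRestrict _ hmem) ⟨?_, ?_⟩).symm⟩
  · intro q q' h
    exact LinearMap.inr_injective (congrArg Subtype.val h)
  · rintro ⟨⟨p, q⟩, N, hN⟩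
    have hp : p = 0 := by
      have := congrArg Prod.fst hN
      exact (smul_eq_zero.mp this).resolve_left (pow_ne_zero _ hf)
    exact ⟨q, Subtype.ext (Prod.ext hp.symm rfl)⟩

theorem rank_free_prod [IsDomain R] {f : R} (hf : f ≠ 0) (r : ℕ) {n : ℕ} (a : Fin n → ℕ) :
    Module.rank R ((Fin r → R) × (Π j, R ⧸ Ideal.span {f ^ a j})) = r := by
  rw [← rank_fin_fun (R := R) r]
  refine le_antisymm ?_ ?_
  · refine rank_le_of_comp_eq_smul (pow_ne_zero (∑ j, a j) hf) (LinearMap.fst R _ _)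
      (f ^ (∑ j, a j) • LinearMap.inl R _ _) ?_
    rintro ⟨p, q⟩
    refine Prod.ext rfl ?_
    simp [pow_sum_smul_pi_quotient]
  · exact rank_le_of_comp_eq_smul one_ne_zero (LinearMap.inl R _ _) (LinearMap.fst R _ _)
      fun y => by simp

end UpToScalar

/-! ### The twisted boundary maps -/

section Boundary

variable {V : Type} [LinearOrder V]

theorem coeffD_insert {R : Type} [CommRing R] (z : V → R) {τ : Finset V} {v : V} (hv : v ∉ τ) :
    coeffD z τ (insert v τ) = (-1) ^ (τ.filter (fun w => w < v)).card * z v := by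
  rw [coeffD, if_pos (Finset.subset_insert v τ), Finset.insert_sdiff_of_notMem _ hv,
    Finset.sdiff_self]
  simp

theorem exists_insert_of_card {τ σ : Finset V} (h : τ ⊆ σ) (hc : σ.card = τ.card + 1) :
    ∃ v, v ∉ τ ∧ σ = insert v τ := by
  obtain ⟨v, hv, hσ⟩ := (Finset.covBy_iff_exists_insert (s := τ) (t := σ)).mp
    (Finset.covBy_iff_card_sdiff_eq_one.mpr ⟨h, by rw [Finset.card_sdiff_of_subset h]; omega⟩)
  exact ⟨v, hv, hσ.symm⟩

theorem coeffD_eq_of_card {R : Type} [CommRing R] {z z' : V → R} {τ σ : Finset V}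
    (hc : σ.card = τ.card + 1) {s s' : R}
    (h : ∀ v, v ∉ τ → σ = insert v τ → z v * s = z' v * s') :
    coeffD z τ σ * s = coeffD z' τ σ * s' := by
  by_cases hs : τ ⊆ σ
  · obtain ⟨v, hv, rfl⟩ := exists_insert_of_card hs hc
    rw [coeffD_insert z hv, coeffD_insert z' hv, mul_assoc, mul_assoc, h v hv rfl]
  · rw [coeffD, coeffD, if_neg hs, if_neg hs, zero_mul, zero_mul]

theorem coeffD_mul_coeffD_swap {R : Type} [CommRing R] (z : V → R) {ρ : Finset V} {u v : V}
    (hu : u ∉ ρ) (hv : v ∉ ρ) (huv : u < v) :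
    coeffD z ρ (insert u ρ) * coeffD z (insert u ρ) (insert v (insert u ρ)) +
      coeffD z ρ (insert v ρ) * coeffD z (insert v ρ) (insert v (insert u ρ)) = 0 := by
  have h1 : v ∉ insert u ρ := by simp [hv, huv.ne']
  have h2 : u ∉ insert v ρ := by simp [hu, huv.ne]
  have h3 : u ∉ ρ.filter (fun w => w < v) := by simp [hu]
  rw [coeffD_insert z hu, coeffD_insert z hv, coeffD_insert z h1, Finset.insert_comm v u,
    coeffD_insert z h2, Finset.filter_insert, if_pos huv, Finset.filter_insert,
    if_neg (not_lt.mpr huv.le), Finset.card_insert_of_notMem h3, pow_succ]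
  ring

theorem coeffD_comp_eq_zero {R : Type} [CommRing R] [Fintype V] (z : V → R)
    {L : Finset (Finset V)} (hL : IsCx L) (c : ℕ) :
    (Matrix.of fun (ρ : Face L c) (τ : Face L (c + 1)) => coeffD z ρ.1 τ.1) *
      (Matrix.of fun (τ : Face L (c + 1)) (σ : Face L (c + 1 + 1)) => coeffD z τ.1 σ.1) = 0 := by
  ext ρ σ
  rw [Matrix.mul_apply, Matrix.zero_apply]
  simp only [Matrix.of_apply]
  by_cases hρσ : ρ.1 ⊆ σ.1
  swap
  · refine Finset.sum_eq_zero fun τ _ => ?_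
    by_cases h : ρ.1 ⊆ τ.1
    · rw [coeffD, coeffD, if_neg (c := τ.1 ⊆ σ.1) fun h' => hρσ (h.trans h'), mul_zero]
    · rw [coeffD, if_neg h, zero_mul]
  have hcard : (σ.1 \ ρ.1).card = 2 := by
    rw [Finset.card_sdiff_of_subset hρσ, σ.2.2, ρ.2.2]
    omega
  obtain ⟨u, v, huv, hσ⟩ : ∃ u v, u < v ∧ σ.1 \ ρ.1 = {u, v} := by
    obtain ⟨u, v, huv, h⟩ := Finset.card_eq_two.mp hcard
    rcases lt_or_gt_of_ne huv with h' | h'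
    · exact ⟨u, v, h', h⟩
    · exact ⟨v, u, h', by rw [h, Finset.pair_comm]⟩
  have hu : u ∈ σ.1 \ ρ.1 := by simp [hσ]
  have hv : v ∈ σ.1 \ ρ.1 := by simp [hσ]
  rw [Finset.mem_sdiff] at hu hv
  have hσ' : σ.1 = insert v (insert u ρ.1) := by
    rw [← Finset.sdiff_union_of_subset hρσ, hσ]
    ext w
    simp only [Finset.mem_union, Finset.mem_insert, Finset.mem_singleton]
    tauto
  have hface : ∀ w ∈ σ.1, w ∉ ρ.1 → insert w ρ.1 ∈ L ∧ (insert w ρ.1).card = c + 1 :=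
    fun w hw hw' => ⟨hL.2 σ.1 σ.2.1 _ (Finset.insert_subset hw hρσ), by
      rw [Finset.card_insert_of_notMem hw', ρ.2.2]⟩
  let τ₁ : Face L (c + 1) := ⟨insert u ρ.1, hface u hu.1 hu.2⟩
  let τ₂ : Face L (c + 1) := ⟨insert v ρ.1, hface v hv.1 hv.2⟩
  have hne : τ₁ ≠ τ₂ := by
    intro h
    have h' : u ∈ insert v ρ.1 := by
      have h₀ : insert u ρ.1 = insert v ρ.1 := congrArg Subtype.val h
      exact h₀ ▸ Finset.mem_insert_self u ρ.1
    rcases Finset.mem_insert.mp h' with h'' | h''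
    exacts [huv.ne h'', hu.2 h'']
  rw [Finset.sum_eq_add τ₁ τ₂ hne]
  · rw [hσ']
    exact coeffD_mul_coeffD_swap z hu.2 hv.2 huv
  · rintro τ - ⟨h1, h2⟩
    by_cases hρτ : ρ.1 ⊆ τ.1
    swap
    · rw [coeffD, if_neg hρτ, zero_mul]
    by_cases hτσ : τ.1 ⊆ σ.1
    swap
    · rw [coeffD, coeffD, if_neg hτσ, mul_zero]
    obtain ⟨w, hw, hτ⟩ := exists_insert_of_card hρτ (by rw [τ.2.2, ρ.2.2])
    have hw' : w ∈ σ.1 \ ρ.1 :=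
      Finset.mem_sdiff.mpr ⟨hτσ (hτ ▸ Finset.mem_insert_self w ρ.1), hw⟩
    rw [hσ, Finset.mem_insert, Finset.mem_singleton] at hw'
    rcases hw' with rfl | rfl
    exacts [absurd (Subtype.ext hτ) h1, absurd (Subtype.ext hτ) h2]
  · exact fun h => absurd (Finset.mem_univ _) h
  · exact fun h => absurd (Finset.mem_univ _) h

variable {k : Type} [Field k]

theorem isHomog_coeffD [Fintype V] (L : Finset (Finset V)) (z : V → k) (b : V → ℕ) (c : ℕ) :
    IsHomog (fun τ : Face L c => ∑ v ∈ τ.1, b v) (fun σ : Face L (c + 1) => ∑ v ∈ σ.1, b v)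
      (Matrix.of fun τ σ => coeffD z τ.1 σ.1) := by
  intro τ σ h
  refine Finset.sum_le_sum_of_subset ?_
  by_contra hs
  exact h (if_neg hs)

theorem tB_eq_homogenize [Fintype V] (R : Type) [CommRing R] [Algebra k R] (x : R)
    (L : Finset (Finset V)) (p : V → Prop) [DecidablePred p] (b : V → ℕ) (c : ℕ) :
    tB R L (fun v => if p v then 0 else x ^ b v) c =
      (homogenize R x (fun τ : Face L c => ∑ v ∈ τ.1, b v)
        (fun σ : Face L (c + 1) => ∑ v ∈ σ.1, b v)
        (Matrix.of fun τ σ => coeffD (fun v => if p v then (0 : k) else 1) τ.1 σ.1)).mulVecLin := by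
  unfold tB
  congr 1
  ext τ σ
  simp only [homogenize, Matrix.of_apply]
  by_cases hs : τ.1 ⊆ σ.1
  · obtain ⟨v, hv, hσ⟩ := exists_insert_of_card hs (by rw [τ.2.2, σ.2.2])
    rw [hσ, coeffD_insert _ hv, coeffD_insert _ hv, Finset.sum_insert hv, Nat.add_sub_cancel]
    split_ifs <;> simp
  · rw [coeffD, coeffD, if_neg hs, if_neg hs, map_zero, zero_mul]

theorem exists_twHomology_decomposition [Fintype V] {L : Finset (Finset V)} (hL : IsCx L)
    (p : V → Prop) [DecidablePred p] (b : V → ℕ) (i : ℕ) :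
    ∃ (r n : ℕ) (a : Fin n → ℕ), (∀ j, 1 ≤ a j) ∧
      ∀ (R : Type) [CommRing R] [IsDomain R] [Algebra k R] (x : R), x ≠ 0 →
        Nonempty (twHomology R L (fun v => if p v then 0 else x ^ b v) i ≃ₗ[R]
          (Fin r → R) × (Π j, R ⧸ Ideal.span {x ^ a j})) := by
  have hc := isHomog_coeffD L (fun v => if p v then (0 : k) else 1) b i
  cases i with
  | zero =>
    obtain ⟨r, n, a, ha, h⟩ := exists_homology_decomposition hc
      (isHomog_zero (I := Empty) Empty.elim _) (Matrix.zero_mul _)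
    refine ⟨r, n, a, ha, fun R _ _ _ x hx => ?_⟩
    have hZ : cyc R L (fun v => if p v then 0 else x ^ b v) 0 =
        LinearMap.ker (homogenize R x Empty.elim (fun τ : Face L 0 => ∑ v ∈ τ.1, b v)
          (0 : Matrix Empty (Face L 0) k)).mulVecLin := by
      rw [homogenize_zero, Matrix.mulVecLin_zero, LinearMap.ker_zero]
      rfl
    unfold twHomology
    rw [hZ, tB_eq_homogenize (k := k)]
    exact h R x hx
  | succ i =>
    obtain ⟨r, n, a, ha, h⟩ := exists_homology_decomposition hc
      (isHomog_coeffD L (fun v => if p v then (0 : k) else 1) b i) (coeffD_comp_eq_zero _ hL i)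
    refine ⟨r, n, a, ha, fun R _ _ _ x hx => ?_⟩
    have hZ : cyc R L (fun v => if p v then 0 else x ^ b v) (i + 1) =
        LinearMap.ker (tB R L (fun v => if p v then 0 else x ^ b v) i) := rfl
    unfold twHomology
    rw [hZ, tB_eq_homogenize (k := k), tB_eq_homogenize (k := k)]
    exact h R x hx

/-- Rescaling the basis element `c_σ` by `s σ`. -/
def rescale [Fintype V] {R : Type} [CommRing R] {L : Finset (Finset V)} (s : Finset V → R)
    (c : ℕ) : (Face L c → R) →ₗ[R] (Face L c → R) :=
  LinearMap.pi fun σ => s σ.1 • LinearMap.proj σ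

theorem tB_rescale [Fintype V] {R : Type} [CommRing R] {L : Finset (Finset V)} {z z' : V → R}
    {s : Finset V → R} (h : ∀ τ v, v ∉ τ → z' v * s (insert v τ) = z v * s τ) (c : ℕ)
    (y : Face L (c + 1) → R) :
    tB R L z' c (rescale s (c + 1) y) = rescale s c (tB R L z c y) := by
  ext τ
  change ∑ σ : Face L (c + 1), coeffD z' τ.1 σ.1 * (s σ.1 * y σ) =
    s τ.1 * ∑ σ : Face L (c + 1), coeffD z τ.1 σ.1 * y σ
  rw [Finset.mul_sum]
  refine Finset.sum_congr rfl fun σ _ => ?_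
  rw [← mul_assoc, coeffD_eq_of_card (z' := z) (s' := s τ.1) (by rw [τ.2.2, σ.2.2])
    (by rintro v hv hσ; rw [hσ]; exact h _ v hv)]
  ring

theorem rescale_mem_cyc [Fintype V] {R : Type} [CommRing R] {L : Finset (Finset V)}
    {z z' : V → R} {s : Finset V → R}
    (h : ∀ τ v, v ∉ τ → z' v * s (insert v τ) = z v * s τ) (i : ℕ) (y : Face L i → R)
    (hy : y ∈ cyc R L z i) : rescale s i y ∈ cyc R L z' i := by
  cases i with
  | zero => exact Submodule.mem_top
  | succ i =>
    have hy' : tB R L z i y = 0 := hy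
    change tB R L z' i _ = 0
    rw [tB_rescale h, hy', map_zero]

theorem rescale_mem_range [Fintype V] {R : Type} [CommRing R] {L : Finset (Finset V)}
    {z z' : V → R} {s : Finset V → R}
    (h : ∀ τ v, v ∉ τ → z' v * s (insert v τ) = z v * s τ) (i : ℕ) (y : Face L i → R)
    (hy : y ∈ LinearMap.range (tB R L z i)) : rescale s i y ∈ LinearMap.range (tB R L z' i) := by
  obtain ⟨x, rfl⟩ := hy
  exact ⟨rescale s (i + 1) x, tB_rescale h i x⟩

/-- Multiplying the weights by scalars `u v` changes twisted homology only up to maps that are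
mutually inverse up to `∏ v, u v`. -/
theorem exists_twHomology_maps [Fintype V] {R : Type} [CommRing R] (L : Finset (Finset V))
    {z z' u : V → R} (hz : ∀ v, z v = u v * z' v) (i : ℕ) :
    ∃ (g : twHomology R L z i →ₗ[R] twHomology R L z' i)
      (h : twHomology R L z' i →ₗ[R] twHomology R L z i),
      (∀ y, h (g y) = (∏ v, u v) • y) ∧ ∀ y, g (h y) = (∏ v, u v) • y := by
  have h1 : ∀ τ v, v ∉ τ → z' v * ∏ w ∈ insert v τ, u w = z v * ∏ w ∈ τ, u w := by
    intro τ v hv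
    rw [Finset.prod_insert hv, hz]
    ring
  have h2 : ∀ τ v, v ∉ τ → z v * ∏ w ∈ (insert v τ)ᶜ, u w = z' v * ∏ w ∈ τᶜ, u w := by
    intro τ v hv
    rw [Finset.compl_insert, ← Finset.mul_prod_erase τᶜ u (Finset.mem_compl.mpr hv), hz]
    ring
  refine ⟨subquotientMap (rescale (fun σ => ∏ w ∈ σ, u w) i) (rescale_mem_cyc h1 i)
      (rescale_mem_range h1 i),
    subquotientMap (rescale (fun σ => ∏ w ∈ σᶜ, u w) i) (rescale_mem_cyc h2 i)
      (rescale_mem_range h2 i), fun y => ?_, fun y => ?_⟩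
  · refine subquotientMap_subquotientMap _ _ _ _ (fun y => ?_) y
    ext σ
    change (∏ w ∈ σ.1ᶜ, u w) * ((∏ w ∈ σ.1, u w) * y σ) = (∏ v, u v) * y σ
    rw [← mul_assoc, mul_comm (∏ w ∈ σ.1ᶜ, u w), Finset.prod_mul_prod_compl]
  · refine subquotientMap_subquotientMap _ _ _ _ (fun y => ?_) y
    ext σ
    change (∏ w ∈ σ.1, u w) * ((∏ w ∈ σ.1ᶜ, u w) * y σ) = (∏ v, u v) * y σ
    rw [← mul_assoc, Finset.prod_mul_prod_compl]

end Boundary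

/-! ### Orders in the ring of Laurent polynomials -/

section Laurent

variable {k : Type} [Field k]

open LaurentPolynomial

theorem T_sub_one_ne_zero {m : ℤ} (hm : m ≠ 0) : (T m - 1 : LaurentPolynomial k) ≠ 0 := by
  intro h
  rw [sub_eq_zero, ← T_zero] at h
  exact hm (AddMonoidAlgebra.single_left_injective one_ne_zero h)

/-- A nonzero Laurent polynomial is the maximal power of an irreducible polynomial `f` times a
cofactor coprime to `f`. -/
theorem exists_eq_pow_ordf_mul {f : Polynomial k} (hf : Irreducible f) {g : LaurentPolynomial k}
    (hg : g ≠ 0) : ∃ u, g = Polynomial.toLaurent f ^ ordf (Polynomial.toLaurent f) g * u ∧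
      IsCoprime u (Polynomial.toLaurent f) := by
  by_cases hunit : IsUnit (Polynomial.toLaurent f)
  · have h := hunit.pow (ordf (Polynomial.toLaurent f) g)
    obtain ⟨u, hu⟩ := h.dvd (a := g)
    obtain ⟨c, hc⟩ := hunit.exists_left_inv
    exact ⟨u, hu, 0, c, by rw [zero_mul, zero_add, hc]⟩
  obtain ⟨n, p, hp⟩ := exists_T_pow g
  have hp0 : p ≠ 0 := by
    rintro rfl
    rw [map_zero] at hp
    exact hg ((isUnit_T (n : ℤ)).mul_left_eq_zero.mp hp.symm)
  obtain ⟨q, hpq, hfq⟩ := (FiniteMultiplicity.of_not_isUnit hf.not_isUnit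
    hp0).exists_eq_pow_mul_and_not_dvd
  set b := multiplicity f p
  have hgp : g = Polynomial.toLaurent f ^ b * (Polynomial.toLaurent q * T (-(n : ℤ))) := by
    rw [← mul_assoc, ← map_pow, ← map_mul, ← hpq, hp, mul_T_assoc]
    simp
  have hcop : IsCoprime (Polynomial.toLaurent q * T (-(n : ℤ))) (Polynomial.toLaurent f) := by
    rw [isCoprime_mul_unit_right_left (isUnit_T _)]
    exact ((hf.coprime_iff_not_dvd.mpr hfq).symm).map Polynomial.toLaurent
  have hord : ordf (Polynomial.toLaurent f) g = b := by
    have hset : {j : ℕ | Polynomial.toLaurent f ^ j ∣ g} = Set.Iic b := by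
      ext j
      rw [Set.mem_ofPred_eq, Set.mem_Iic]
      refine ⟨fun h => ?_, fun h => (pow_dvd_pow _ h).trans ⟨_, hgp⟩⟩
      by_contra hj
      have h1 := (pow_dvd_pow (Polynomial.toLaurent f) (not_le.mp hj)).trans h
      rw [Nat.succ_eq_add_one, pow_succ, hgp] at h1
      have hf0 : Polynomial.toLaurent f ≠ 0 := Polynomial.toLaurent_ne_zero.mpr hf.ne_zero
      have h2 := (mul_dvd_mul_iff_left (pow_ne_zero b hf0)).mp h1
      exact hunit (hcop.isUnit_of_dvd' h2 dvd_rfl)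
    rw [ordf, hset, csSup_Iic]
  exact ⟨_, by rw [hord]; exact hgp, hcop⟩

end Laurent

open LaurentPolynomial in
/-- Write `Λ = k[t,t⁻¹]`, `S = k[[t]]`, `γ_v = t^{m_v} − 1 ∈ Λ`,
`b_v = ord_f(t^{m_v} − 1)` and `ξ_v = t^{b_v} ∈ S` for `m_v ≠ 0`, `ξ_v = 0` for
`m_v = 0`.  Then the `Λ`-rank of `H_i(C_•(T_L, Λ_γ))` equals the `S`-rank of
`H_i(C_•(T_L, S_ξ))`, and the multiplicities of the `f`-primary Jordan blocks of the
former agree with the multiplicities of the `t`-primary blocks of the latter: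
there are `r, n` and block sizes `a : Fin n → ℕ`, `a j ≥ 1`, such that the
`f`-primary part of `H_i(C_•(T_L, Λ_γ))` is `⊕_j Λ/f^{a_j}Λ`, the `Λ`-rank is `r`,
and `H_i(C_•(T_L, S_ξ)) ≅ S^r ⊕ ⊕_j S/t^{a_j}S`. -/
theorem statement14 {V : Type} [Fintype V] [LinearOrder V] (k : Type) [Field k]
    (L : Finset (Finset V)) (hL : IsCx L) (hV : ∀ v : V, {v} ∈ L)
    (m : V → ℤ) (hgcd : Finset.univ.gcd m = 1)
    (f : Polynomial k) (hf : Irreducible f) (hfX : f ≠ Polynomial.X) :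
    ∀ i : ℕ, ∃ (r n : ℕ) (a : Fin n → ℕ),
      (∀ j : Fin n, 1 ≤ a j) ∧
      Module.rank (LaurentPolynomial k)
          (twHomology (LaurentPolynomial k) L (fun v => T (m v) - 1) i) = (r : Cardinal) ∧
      Nonempty
        (↥(fPrimary (LaurentPolynomial k) (Polynomial.toLaurent f)
            (twHomology (LaurentPolynomial k) L (fun v => T (m v) - 1) i))
          ≃ₗ[LaurentPolynomial k]
         (Π j : Fin n, LaurentPolynomial k ⧸
            Ideal.span {Polynomial.toLaurent f ^ (a j)})) ∧
      Nonempty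
        (twHomology (PowerSeries k) L
            (fun v => if m v = 0 then 0 else
              (PowerSeries.X : PowerSeries k) ^
                (ordf (Polynomial.toLaurent f) (T (m v) - 1))) i
          ≃ₗ[PowerSeries k]
         ((Fin r → PowerSeries k) ×
          (Π j : Fin n, PowerSeries k ⧸
            Ideal.span {(PowerSeries.X : PowerSeries k) ^ (a j)}))) := by
  intro i
  have hF : Polynomial.toLaurent f ≠ 0 := Polynomial.toLaurent_ne_zero.mpr hf.ne_zero
  obtain ⟨r, n, a, ha, hdec⟩ := exists_twHomology_decomposition (k := k) hL (fun v => m v = 0)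
    (fun v => ordf (Polynomial.toLaurent f) (T (m v) - 1)) i
  refine ⟨r, n, a, ha, ?_⟩
  have hu : ∀ v, ∃ u : LaurentPolynomial k, u ≠ 0 ∧ IsCoprime u (Polynomial.toLaurent f) ∧
      T (m v) - 1 = u * (if m v = 0 then 0 else
        Polynomial.toLaurent f ^ ordf (Polynomial.toLaurent f) (T (m v) - 1)) := by
    intro v
    by_cases hv : m v = 0
    · exact ⟨1, one_ne_zero, isCoprime_one_left, by simp [hv]⟩
    · have hne := T_sub_one_ne_zero (k := k) hv
      obtain ⟨u, hu, hcop⟩ := exists_eq_pow_ordf_mul hf hne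
      refine ⟨u, ?_, hcop, by rw [if_neg hv, mul_comm]; exact hu⟩
      rintro rfl
      exact hne (by rw [hu, mul_zero])
  choose u hu0 hcop hu using hu
  obtain ⟨g, h, hgh, hhg⟩ := exists_twHomology_maps L hu i
  obtain ⟨e⟩ := hdec (LaurentPolynomial k) _ hF
  have hprod : ∏ v, u v ≠ 0 := Finset.prod_ne_zero_iff.mpr fun v _ => hu0 v
  refine ⟨?_, ?_, hdec (PowerSeries k) _ PowerSeries.X_ne_zero⟩
  · rw [← rank_free_prod hF r a, ← e.rank_eq]
    exact le_antisymm (rank_le_of_comp_eq_smul hprod g h hgh)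
      (rank_le_of_comp_eq_smul hprod h g hhg)
  · obtain ⟨e₁⟩ := nonempty_fPrimary_equiv (IsCoprime.prod_left fun v _ => hcop v) g h hgh hhg
    obtain ⟨e₂⟩ := nonempty_fPrimary_equiv (f := Polynomial.toLaurent f) isCoprime_one_left
      e.toLinearMap e.symm.toLinearMap (by simp) (by simp)
    obtain ⟨e₃⟩ := nonempty_fPrimary_free_prod hF r a
    exact ⟨e₁.trans (e₂.trans e₃)⟩
end
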